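/- arXiv:1206.5209 — 2 statements merged into one kernel-verified Lean document; each statement's English description precedes it below -/
import Mathlib

section
/- Quantitative observability on an interior time interval: There exist constants C > 0 and c'' > 0 such that for every T ≥ 1, every a ≥ 0, every ε ∈ (0,1), and every classical solution φ of (S'^a), one has ∫_{T/4}^{3T/4} ‖φ(t,·)‖²_{X¹} dt ≤ C exp( c'' ε^{−1} max{(aε)^{1/2}, 1} ) · ∫_0^T |φ(t,0)|² dt. -/
open Real MeasureTheory intervalIntegral Set

noncomputable section

/-- A classical solution of the one-dimensional adjoint system `(S'^a)`:
`φ ∈ C^∞`, satisfying `∂_t φ + ∂_x φ + ε ∂_x² φ − a φ = 0` on `Q = (0,T)×(−1,0)`,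
the boundary condition `ε(∂_t φ(t,0) − ∂_x φ(t,0)) − φ(t,0) = 0` and
`∂_t φ(t,−1) + ∂_x φ(t,−1) = 0` for `t ∈ (0,T)`. -/
def IsAdjSol1D (T ε a : ℝ) (φ : ℝ → ℝ → ℝ) : Prop :=
  ContDiff ℝ (⊤ : ℕ∞) (fun p : ℝ × ℝ => φ p.1 p.2) ∧
  (∀ t ∈ Set.Ioo (0:ℝ) T, ∀ x ∈ Set.Ioo (-1:ℝ) 0,
    deriv (fun s => φ s x) t + deriv (fun y => φ t y) x
      + ε * deriv (deriv (fun y => φ t y)) x - a * φ t x = 0) ∧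
  (∀ t ∈ Set.Ioo (0:ℝ) T,
    ε * (deriv (fun s => φ s 0) t - deriv (fun y => φ t y) 0) - φ t 0 = 0) ∧
  (∀ t ∈ Set.Ioo (0:ℝ) T,
    deriv (fun s => φ s (-1)) t + deriv (fun y => φ t y) (-1) = 0)

/-- The squared `X¹`-norm: `‖ψ‖²_{X¹} = ∫_{−1}^0 |ψ|² + ε(|ψ(0)|² + |ψ(−1)|²)`. -/
def X1normSq (ε : ℝ) (ψ : ℝ → ℝ) : ℝ :=
  (∫ x in (-1:ℝ)..0, ψ x ^ 2) + ε * (ψ 0 ^ 2 + ψ (-1) ^ 2)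


/-! ### Calculus with parameters -/

lemma hasDerivAt_fst_of_contDiff {f : ℝ → ℝ → ℝ}
    (hf : ContDiff ℝ (⊤ : ℕ∞) (fun p : ℝ × ℝ => f p.1 p.2)) (t x : ℝ) :
    HasDerivAt (fun s => f s x) (deriv (fun s => f s x) t) t := by
  have h : ContDiff ℝ (⊤ : ℕ∞) (fun s : ℝ => f s x) :=
    hf.comp (contDiff_id.prodMk contDiff_const)
  exact (h.differentiable (by simp) t).hasDerivAt

lemma hasDerivAt_snd_of_contDiff {f : ℝ → ℝ → ℝ}
    (hf : ContDiff ℝ (⊤ : ℕ∞) (fun p : ℝ × ℝ => f p.1 p.2)) (t x : ℝ) :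
    HasDerivAt (fun y => f t y) (deriv (fun y => f t y) x) x := by
  have h : ContDiff ℝ (⊤ : ℕ∞) (fun y : ℝ => f t y) :=
    hf.comp (contDiff_const.prodMk contDiff_id)
  exact (h.differentiable (by simp) x).hasDerivAt

lemma contDiff_deriv_fst {f : ℝ → ℝ → ℝ}
    (hf : ContDiff ℝ (⊤ : ℕ∞) (fun p : ℝ × ℝ => f p.1 p.2)) :
    ContDiff ℝ (⊤ : ℕ∞) (fun p : ℝ × ℝ => deriv (fun s => f s p.2) p.1) := by
  have h : ∀ p : ℝ × ℝ, deriv (fun s => f s p.2) p.1 =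
      fderiv ℝ (fun p : ℝ × ℝ => f p.1 p.2) p ((1 : ℝ), (0 : ℝ)) := fun p => by
    have h1 := (hf.differentiable (by simp) p).hasFDerivAt
    exact (HasFDerivAt.comp_hasDerivAt (f := fun s : ℝ => (s, p.2)) p.1 h1
      ((hasDerivAt_id p.1).prodMk (hasDerivAt_const p.1 p.2))).deriv
  simp_rw [h]
  exact (hf.fderiv_right (m := (⊤ : ℕ∞)) (by simp)).clm_apply contDiff_const

lemma contDiff_deriv_snd {f : ℝ → ℝ → ℝ}
    (hf : ContDiff ℝ (⊤ : ℕ∞) (fun p : ℝ × ℝ => f p.1 p.2)) :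
    ContDiff ℝ (⊤ : ℕ∞) (fun p : ℝ × ℝ => deriv (fun y => f p.1 y) p.2) := by
  have h : ∀ p : ℝ × ℝ, deriv (fun y => f p.1 y) p.2 =
      fderiv ℝ (fun p : ℝ × ℝ => f p.1 p.2) p ((0 : ℝ), (1 : ℝ)) := fun p => by
    have h1 := (hf.differentiable (by simp) p).hasFDerivAt
    exact (HasFDerivAt.comp_hasDerivAt (f := fun y : ℝ => (p.1, y)) p.2 h1
      ((hasDerivAt_const p.2 p.1).prodMk (hasDerivAt_id p.2))).deriv
  simp_rw [h]
  exact (hf.fderiv_right (m := (⊤ : ℕ∞)) (by simp)).clm_apply contDiff_const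

lemma hasDerivAt_intervalIntegral_param {F F' : ℝ → ℝ → ℝ}
    (hF : Continuous (fun p : ℝ × ℝ => F p.1 p.2))
    (hF' : Continuous (fun p : ℝ × ℝ => F' p.1 p.2))
    (h : ∀ t x, HasDerivAt (fun s => F s x) (F' t x) t) (a b t : ℝ) :
    HasDerivAt (fun s => ∫ x in a..b, F s x) (∫ x in a..b, F' t x) t := by
  obtain ⟨M, hM⟩ := (isCompact_Icc.prod isCompact_uIcc :
    IsCompact (Icc (t - 1) (t + 1) ×ˢ uIcc a b)).exists_bound_of_continuousOn hF'.continuousOn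
  have hFs : ∀ s, Continuous (F s) := fun s => hF.comp (by fun_prop : Continuous fun x => (s, x))
  have hFs' : ∀ s, Continuous (F' s) := fun s =>
    hF'.comp (by fun_prop : Continuous fun x => (s, x))
  refine (intervalIntegral.hasDerivAt_integral_of_dominated_loc_of_deriv_le
    (s := Icc (t - 1) (t + 1)) (bound := fun _ => M) (Icc_mem_nhds (by linarith) (by linarith))
    (Filter.Eventually.of_forall fun s => (hFs s).aestronglyMeasurable)
    ((hFs t).intervalIntegrable _ _) (hFs' t).aestronglyMeasurable ?_ (by simp) ?_).2
  · exact Filter.Eventually.of_forall fun x hx s hs => hM (s, x) ⟨hs, uIoc_subset_uIcc hx⟩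
  · exact Filter.Eventually.of_forall fun x _ s _ => h s x

lemma integral_integral_swap_of_continuous {F : ℝ → ℝ → ℝ}
    (hF : Continuous (fun p : ℝ × ℝ => F p.1 p.2)) (a b c d : ℝ) :
    ∫ x in a..b, ∫ y in c..d, F x y = ∫ y in c..d, ∫ x in a..b, F x y :=
  intervalIntegral_intervalIntegral_swap
    ((hF.continuousOn.integrableOn_compact (isCompact_uIcc.prod isCompact_uIcc)).mono_set
      (prod_mono uIoc_subset_uIcc uIoc_subset_uIcc))

lemma sq_integral_le_mul_integral_sq {f : ℝ → ℝ} (hf : Continuous f) {δ : ℝ} (hδ : 0 < δ) :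
    (∫ t in (0 : ℝ)..δ, f t) ^ 2 ≤ δ * ∫ t in (0 : ℝ)..δ, f t ^ 2 := by
  set I := ∫ t in (0 : ℝ)..δ, f t with hI
  have h : 0 ≤ ∫ t in (0 : ℝ)..δ, (f t - I / δ) ^ 2 :=
    intervalIntegral.integral_nonneg hδ.le fun _ _ => sq_nonneg _
  have e : ∫ t in (0 : ℝ)..δ, (f t - I / δ) ^ 2 =
      ∫ t in (0 : ℝ)..δ, (f t ^ 2 - 2 * (I / δ) * f t + (I / δ) ^ 2) :=
    intervalIntegral.integral_congr fun t _ => by ring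
  have i1 : IntervalIntegrable (fun t => f t ^ 2) volume 0 δ := (hf.pow 2).intervalIntegrable _ _
  have i2 := (hf.intervalIntegrable (μ := volume) 0 δ).const_mul (2 * (I / δ))
  rw [e, intervalIntegral.integral_add (i1.sub i2) intervalIntegrable_const,
    intervalIntegral.integral_sub i1 i2, intervalIntegral.integral_const_mul,
    intervalIntegral.integral_const, ← hI] at h
  have h2 := mul_nonneg hδ.le h
  have h3 : δ * ((∫ t in (0 : ℝ)..δ, f t ^ 2) - 2 * (I / δ) * I + (δ - 0) • (I / δ) ^ 2) =
      δ * (∫ t in (0 : ℝ)..δ, f t ^ 2) - I ^ 2 := by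
    simp only [smul_eq_mul]
    field_simp
    ring
  linarith

/-- Taylor's inequality for a tower of functions, each of which is the derivative of the
preceding one. -/
lemma abs_le_taylor_of_hasDerivAt (n : ℕ) : ∀ (g : ℕ → ℝ → ℝ) (M : ℝ),
    (∀ k, ∀ x ∈ Icc (0 : ℝ) 1, HasDerivWithinAt (g k) (g (k + 1) x) (Icc 0 1) x) →
    (∀ x ∈ Icc (0 : ℝ) 1, |g n x| ≤ M) → ∀ x ∈ Icc (0 : ℝ) 1,
    |g 0 x| ≤ ∑ k ∈ Finset.range n, |g k 0| * (x ^ k / k.factorial) +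
      M * (x ^ n / n.factorial) := by
  induction n with
  | zero => intro g M _ hM x hx; simpa using hM x hx
  | succ n ih =>
    intro g M hg hM x hx
    have hpow : ∀ (k : ℕ) (x : ℝ), HasDerivAt (fun x : ℝ => x ^ (k + 1) / (k + 1).factorial)
        (x ^ k / k.factorial) x := fun k x => by
      refine ((hasDerivAt_pow (k + 1) x).div_const ((k + 1).factorial : ℝ)).congr_deriv ?_
      rw [Nat.factorial_succ]
      push_cast
      have : (k.factorial : ℝ) ≠ 0 := by positivity
      field_simp
    refine image_norm_le_of_norm_deriv_right_le_deriv_boundary (f := g 0) (f' := g 1)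
      (B := fun x => ∑ k ∈ Finset.range (n + 1), |g k 0| * (x ^ k / k.factorial) +
        M * (x ^ (n + 1) / (n + 1).factorial))
      (B' := fun x => ∑ k ∈ Finset.range n, |g (k + 1) 0| * (x ^ k / k.factorial) +
        M * (x ^ n / n.factorial))
      (fun y hy => (hg 0 y hy).continuousWithinAt) (fun y hy => ?_) ?_ (fun y => ?_)
      (fun y hy => ?_) hx
    · exact ((hg 0 y (Ico_subset_Icc_self hy)).mono_of_mem_nhdsWithin
        (Icc_mem_nhdsGE_of_mem hy))
    · simp [Finset.sum_range_succ']
    · simp only [Finset.sum_range_succ']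
      refine HasDerivAt.add ?_ ((hpow n y).const_mul M)
      have h1 : HasDerivAt (fun x : ℝ => ∑ k ∈ Finset.range n,
          |g (k + 1) 0| * (x ^ (k + 1) / (k + 1).factorial))
          (∑ k ∈ Finset.range n, |g (k + 1) 0| * (y ^ k / k.factorial)) y :=
        HasDerivAt.fun_sum fun k _ => (hpow k y).const_mul _
      simpa using h1.add_const (|g 0 0|)
    · exact ih (fun k => g (k + 1)) M (fun k => hg (k + 1)) hM y (Ico_subset_Icc_self hy)

/-! ### A Gevrey bump function -/

lemma exists_gevrey_bump {κ δ : ℝ} (hκ : 0 < κ) (hδ : 0 < δ) :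
    ∃ ρ : ℝ → ℝ, ContDiff ℝ (⊤ : ℕ∞) ρ ∧ (∀ t, 0 ≤ ρ t) ∧
      (∀ i, iteratedDeriv i ρ 0 = 0) ∧ (∀ i, iteratedDeriv i ρ δ = 0) ∧
      (∀ i, ∀ t ∈ Icc 0 δ, |iteratedDeriv i ρ t| ≤ (9 / κ) ^ i * (2 * i).factorial) ∧
      (∀ t ∈ Icc (δ / 3) (2 * δ / 3), Real.exp (-(6 * κ / δ)) ≤ ρ t) := by
  set ρ : ℝ → ℝ := fun t => expNegInvGlue (t / κ) * expNegInvGlue ((δ - t) / κ) with hρdef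
  have hρ : ContDiff ℝ (⊤ : ℕ∞) ρ :=
    (expNegInvGlue.contDiff.comp (contDiff_id.div_const κ)).mul
      (expNegInvGlue.contDiff.comp ((contDiff_const.sub contDiff_id).div_const κ))
  have hval : ∀ t ∈ Ioo 0 δ, ρ t = Real.exp (-(κ / t) - κ / (δ - t)) := fun t ht => by
    have h1 : 0 < t := ht.1
    have h2 : 0 < δ - t := sub_pos.2 ht.2
    simp only [hρdef, expNegInvGlue, not_le.2 (div_pos h1 hκ), not_le.2 (div_pos h2 hκ), if_false]
    rw [← Real.exp_add]
    rw [inv_div, inv_div, ← sub_eq_add_neg]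
  have hcont : ∀ i, Continuous (iteratedDeriv i ρ) := fun i =>
    hρ.continuous_iteratedDeriv i (by exact_mod_cast le_top)
  have hzl : ∀ i, ∀ t < 0, iteratedDeriv i ρ t = 0 := fun i t ht => by
    have : ρ =ᶠ[nhds t] fun _ => 0 := by
      filter_upwards [Iio_mem_nhds ht] with s hs
      simp [hρdef, expNegInvGlue.zero_of_nonpos (div_nonpos_of_nonpos_of_nonneg hs.le hκ.le)]
    rw [this.iteratedDeriv_eq i]
    simp
  have hzr : ∀ i, ∀ t > δ, iteratedDeriv i ρ t = 0 := fun i t ht => by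
    have : ρ =ᶠ[nhds t] fun _ => 0 := by
      filter_upwards [Ioi_mem_nhds ht] with s hs
      simp [hρdef, expNegInvGlue.zero_of_nonpos
        (div_nonpos_of_nonpos_of_nonneg (sub_nonpos.2 (le_of_lt hs)) hκ.le)]
    rw [this.iteratedDeriv_eq i]
    simp
  have h0 : ∀ i, iteratedDeriv i ρ 0 = 0 := fun i => by
    have : EqOn (iteratedDeriv i ρ) (fun _ => 0) (closure (Iio 0)) :=
      EqOn.closure (fun t ht => hzl i t ht) (hcont i) continuous_const
    exact this (by simp)
  have hd : ∀ i, iteratedDeriv i ρ δ = 0 := fun i => by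
    have : EqOn (iteratedDeriv i ρ) (fun _ => 0) (closure (Ioi δ)) :=
      EqOn.closure (fun t ht => hzr i t ht) (hcont i) continuous_const
    exact this (by simp)
  refine ⟨ρ, hρ, fun t => mul_nonneg (expNegInvGlue.nonneg _) (expNegInvGlue.nonneg _), h0, hd,
    fun i t ht => ?_, fun t ht => ?_⟩
  · rcases eq_or_lt_of_le ht.1 with rfl | ht1
    · rw [h0]; simp; positivity
    rcases eq_or_lt_of_le ht.2 with rfl | ht2
    · rw [hd]; simp; positivity
    set f : ℂ → ℂ := fun z => Complex.exp (-(κ / z) - κ / (δ - z)) with hf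
    set U : Set ℂ := {z | z ≠ 0 ∧ (δ : ℂ) - z ≠ 0} with hU
    have hUo : IsOpen U := (isOpen_ne_fun continuous_id continuous_const).inter
      (isOpen_ne_fun (continuous_const.sub continuous_id) continuous_const)
    have hfd : DifferentiableOn ℂ f U := fun z hz => by
      have h1 : z ≠ 0 := hz.1
      have h2 : (δ : ℂ) - z ≠ 0 := hz.2
      exact (by fun_prop (disch := assumption) : DifferentiableAt ℂ f z).differentiableWithinAt
    have hfa : ∀ i, ∀ z ∈ U, DifferentiableAt ℂ (iteratedDeriv i f) z := fun i z hz => by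
      have := (hfd.analyticOnNhd hUo).iterated_deriv i z hz
      rw [← iteratedDeriv_eq_iterate] at this
      exact this.differentiableAt
    have hmem : ∀ t ∈ Ioo 0 δ, (t : ℂ) ∈ U := fun t ht =>
      ⟨by exact_mod_cast ht.1.ne', by exact_mod_cast (sub_pos.2 ht.2).ne'⟩
    have hre : ∀ i, ∀ t ∈ Ioo 0 δ, iteratedDeriv i ρ t = (iteratedDeriv i f t).re := by
      intro i
      induction i with
      | zero =>
        intro t ht
        rw [iteratedDeriv_zero, iteratedDeriv_zero, hval t ht]
        simp only [hf]
        norm_cast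
      | succ i ih =>
        intro t ht
        rw [iteratedDeriv_succ, iteratedDeriv_succ]
        have h1 := (hfa i t (hmem t ht)).hasDerivAt.real_of_complex
        rw [← h1.deriv]
        refine Filter.EventuallyEq.deriv_eq ?_
        filter_upwards [Ioo_mem_nhds ht.1 ht.2] with s hs using ih s hs
    rw [hre i t ⟨ht1, ht2⟩]
    refine (Complex.abs_re_le_norm _).trans ?_
    set d := min t (δ - t) with hdd
    have hd0 : 0 < d := lt_min ht1 (sub_pos.2 ht2)
    have hdt : d ≤ t := min_le_left _ _
    have hdt' : d ≤ δ - t := min_le_right _ _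
    have hball : ∀ z : ℂ, ‖z - t‖ ≤ d / 2 → d / 2 ≤ z.re ∧ d / 2 ≤ δ - z.re := fun z hz => by
      have h1 := (Complex.abs_re_le_norm (z - t)).trans hz
      simp only [Complex.sub_re, Complex.ofReal_re] at h1
      have h2 := abs_le.1 h1
      constructor <;> linarith [h2.1, h2.2]
    have hsub : Metric.closedBall (t : ℂ) (d / 2) ⊆ U := fun z hz => by
      rw [mem_closedBall_iff_norm] at hz
      obtain ⟨h1, h2⟩ := hball z hz
      constructor
      · rintro rfl
        simp at h1; linarith
      · intro h
        have := congrArg Complex.re h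
        simp at this; linarith
    have hmain : ∀ (u : ℂ) (s : ℝ), ‖u - s‖ ≤ s / 2 → 0 < s → 2 * κ / (9 * s) ≤ (κ / u).re := by
      intro u s hu hs
      have hsq : ‖u - s‖ ^ 2 ≤ (s / 2) ^ 2 := by gcongr
      rw [← Complex.normSq_eq_norm_sq, Complex.normSq_apply] at hsq
      simp only [Complex.sub_re, Complex.sub_im, Complex.ofReal_re, Complex.ofReal_im] at hsq
      have hre1 : s / 2 ≤ u.re := by nlinarith [mul_self_nonneg u.im]
      have hns : Complex.normSq u = u.re * u.re + u.im * u.im := Complex.normSq_apply u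
      have hpos : 0 < Complex.normSq u := by rw [hns]; nlinarith [mul_self_nonneg u.im]
      have : (κ / u).re = κ * u.re / Complex.normSq u := by
        simp [Complex.div_re]
      rw [this, div_le_div_iff₀ (by positivity) hpos, hns]
      have : 2 * (u.re * u.re + u.im * u.im) ≤ u.re * (9 * s) := by nlinarith
      nlinarith
    have hnonneg : ∀ u : ℂ, 0 ≤ u.re → 0 ≤ (κ / u).re := fun u hu => by
      have : (κ / u).re = κ * u.re / Complex.normSq u := by simp [Complex.div_re]
      rw [this]
      exact div_nonneg (mul_nonneg hκ.le hu) (Complex.normSq_nonneg _)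
    have hbound : ∀ z ∈ Metric.sphere (t : ℂ) (d / 2), ‖f z‖ ≤ Real.exp (-(2 * κ / (9 * d))) := by
      intro z hz
      rw [mem_sphere_iff_norm] at hz
      obtain ⟨h1, h2⟩ := hball z hz.le
      rw [hf, Complex.norm_exp]
      refine Real.exp_le_exp.2 ?_
      rw [Complex.sub_re, Complex.neg_re]
      rcases min_choice t (δ - t) with h | h
      · have h3 := hmain z d (by rw [hdd, h, hz, hdd, h]) hd0
        have h4 := hnonneg (δ - z) (by simp; linarith)
        linarith
      · have h3 := hmain (δ - z) d (by
          rw [hdd, h, ← norm_neg]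
          rw [hdd, h] at hz
          rw [← hz]
          push_cast
          ring_nf
          exact le_refl _) hd0
        have h4 := hnonneg z (by linarith)
        linarith
    have hcauchy := Complex.norm_iteratedDeriv_le_of_forall_mem_sphere_norm_le i (half_pos hd0)
      ((hfd.mono hsub).diffContOnCl_ball subset_rfl) hbound
    refine hcauchy.trans ?_
    have hexp : Real.exp (-(2 * κ / (9 * d))) ≤ i.factorial / (2 * κ / (9 * d)) ^ i := by
      have h1 := Real.pow_div_factorial_le_exp (2 * κ / (9 * d)) (by positivity) i
      rw [Real.exp_neg, inv_le_comm₀ (Real.exp_pos _) (by positivity), inv_div]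
      exact h1
    have hfac : (i.factorial : ℝ) * i.factorial ≤ (2 * i).factorial := by
      rw [two_mul]
      exact_mod_cast Nat.le_of_dvd (Nat.factorial_pos _) (Nat.factorial_mul_factorial_dvd_factorial_add i i)
    calc i.factorial * Real.exp (-(2 * κ / (9 * d))) / (d / 2) ^ i
        ≤ i.factorial * (i.factorial / (2 * κ / (9 * d)) ^ i) / (d / 2) ^ i := by gcongr
      _ = (9 / κ) ^ i * (i.factorial * i.factorial) := by
        have : (2 * κ / (9 * d)) ^ i * (d / 2) ^ i * (9 / κ) ^ i = 1 := by
          rw [← mul_pow, ← mul_pow]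
          rw [show 2 * κ / (9 * d) * (d / 2) * (9 / κ) = 1 by field_simp]
          simp
        rw [← mul_one (_ / _ : ℝ), ← this]
        field_simp
      _ ≤ _ := by gcongr
  · have ht1 : 0 < t := by linarith [ht.1]
    have ht2 : t < δ := by linarith [ht.2]
    rw [hval t ⟨ht1, ht2⟩]
    refine Real.exp_le_exp.2 ?_
    have h1 : κ / t ≤ κ / (δ / 3) := div_le_div_of_nonneg_left hκ.le (by positivity) ht.1
    have h2 : κ / (δ - t) ≤ κ / (δ / 3) :=
      div_le_div_of_nonneg_left hκ.le (by positivity) (by linarith [ht.2])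
    have h3 : 6 * κ / δ = κ / (δ / 3) + κ / (δ / 3) := by field_simp; norm_num
    linarith

/-! ### Sideways estimate for time averages of solutions -/

lemma abs_le_of_alternating_tower {A B : ℕ → ℝ → ℝ} {D K : ℝ}
    (hA : ∀ i, ∀ y ∈ Icc (0 : ℝ) 1, HasDerivAt (A i) (B i y) y)
    (hB : ∀ i, ∀ y ∈ Icc (0 : ℝ) 1, HasDerivAt (B i) (A (i + 1) y) y)
    (hA0 : ∀ i, |A i 0| ≤ D * (1 / 2) ^ i * (2 * i).factorial)
    (hB0 : ∀ i, |B i 0| ≤ D * (1 / 2) ^ i * (2 * i + 1).factorial)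
    (hK : ∀ i, ∀ y ∈ Icc (0 : ℝ) 1, |A i y| ≤ K * (1 / 4) ^ i * (2 * i).factorial) :
    ∀ y ∈ Icc (0 : ℝ) 1, |A 0 y| ≤ 4 * D := by
  intro y hy
  set g : ℕ → ℝ → ℝ := fun k => if k % 2 = 0 then A (k / 2) else B (k / 2) with hg
  have he : ∀ i, g (2 * i) = A i := fun i => by simp [hg]
  have ho : ∀ i, g (2 * i + 1) = B i := fun i => by
    simp only [hg]
    rw [if_neg (by omega), show (2 * i + 1) / 2 = i by omega]
  have hder : ∀ k, ∀ x ∈ Icc (0 : ℝ) 1, HasDerivWithinAt (g k) (g (k + 1) x) (Icc 0 1) x := by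
    intro k x hx
    obtain ⟨i, rfl | rfl⟩ := Nat.even_or_odd' k
    · rw [he, ho]; exact (hA i x hx).hasDerivWithinAt
    · rw [ho, show 2 * i + 1 + 1 = 2 * (i + 1) by ring, he]; exact (hB i x hx).hasDerivWithinAt
  have hD : 0 ≤ D := by have := (abs_nonneg _).trans (hA0 0); simpa using this
  have hKn : 0 ≤ K := by have := (abs_nonneg _).trans (hK 0 0 (by simp)); simpa using this
  have hterm : ∀ (k : ℕ) (c : ℝ), |g k 0| ≤ c * k.factorial → |g k 0| * (y ^ k / k.factorial) ≤ c := by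
    intro k c h
    have hf : (0 : ℝ) < k.factorial := by positivity
    have hy1 : y ^ k ≤ 1 := pow_le_one₀ hy.1 hy.2
    calc |g k 0| * (y ^ k / k.factorial) ≤ |g k 0| * (1 / k.factorial) := by gcongr
      _ ≤ c := by rw [mul_one_div, div_le_iff₀ hf]; exact h
  have hsum : ∀ n, ∑ k ∈ Finset.range (2 * n), |g k 0| * (y ^ k / k.factorial) ≤
      4 * D - 4 * D * (1 / 2) ^ n := by
    intro n
    induction n with
    | zero => simp
    | succ n ih =>
      rw [show 2 * (n + 1) = 2 * n + 1 + 1 by ring, Finset.sum_range_succ, Finset.sum_range_succ,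
        pow_succ (1 / 2 : ℝ)]
      have h1 := hterm (2 * n) _ (by rw [he]; exact hA0 n)
      have h2 := hterm (2 * n + 1) _ (by rw [ho]; exact hB0 n)
      linarith
  have hbd : ∀ n : ℕ, |A 0 y| ≤ 4 * D + K * (1 / 4) ^ n := by
    intro n
    have h1 := abs_le_taylor_of_hasDerivAt (2 * n) g (K * (1 / 4) ^ n * (2 * n).factorial) hder
      (by rw [he]; exact hK n) y hy
    have h2 := he 0
    rw [mul_zero] at h2
    rw [h2] at h1
    have hf : (0 : ℝ) < (2 * n).factorial := by positivity
    have hy1 : y ^ (2 * n) ≤ 1 := pow_le_one₀ hy.1 hy.2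
    have h3 : K * (1 / 4) ^ n * (2 * n).factorial * (y ^ (2 * n) / (2 * n).factorial) ≤
        K * (1 / 4) ^ n := by
      rw [mul_assoc, mul_div_cancel₀ _ hf.ne']
      exact mul_le_of_le_one_right (by positivity) hy1
    have h4 : 0 ≤ 4 * D * (1 / 2) ^ n := by positivity
    linarith [hsum n]
  refine ge_of_tendsto' (f := fun n : ℕ => 4 * D + K * (1 / 4) ^ n) (x := Filter.atTop) ?_ hbd
  have := ((tendsto_pow_atTop_nhds_zero_of_lt_one (r := (1 / 4 : ℝ)) (by norm_num)
    (by norm_num)).const_mul K).const_add (4 * D)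
  simpa using this

lemma add_one_mul_quarter_pow_le (i : ℕ) : ((i : ℝ) + 1) * (1 / 4) ^ i ≤ (1 / 2) ^ i := by
  have h : ((i : ℝ) + 1) ≤ 2 ^ i := by exact_mod_cast Nat.succ_le_of_lt i.lt_two_pow_self
  calc ((i : ℝ) + 1) * (1 / 4) ^ i ≤ 2 ^ i * (1 / 4) ^ i := by gcongr
    _ = (1 / 2) ^ i := by rw [← mul_pow]; norm_num

lemma abs_average_le_of_backward_heat {ψ : ℝ → ℝ → ℝ} {ρ : ℝ → ℝ} {δ ε b : ℝ}
    (hψ : ContDiff ℝ (⊤ : ℕ∞) (fun p : ℝ × ℝ => ψ p.1 p.2)) (hρ : ContDiff ℝ (⊤ : ℕ∞) ρ)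
    (hδ : 0 < δ) (hε : ε ∈ Ioo (0 : ℝ) 1)
    (hpde : ∀ t ∈ Icc 0 δ, ∀ x ∈ Icc (-1 : ℝ) 0,
      deriv (fun s => ψ s x) t + ε * deriv (deriv (fun y => ψ t y)) x = 0)
    (hbc : ∀ t ∈ Icc 0 δ,
      deriv (fun s => ψ s 0) t = deriv (fun y => ψ t y) 0 - b * ψ t 0)
    (hρ0 : ∀ i, iteratedDeriv i ρ 0 = 0) (hρδ : ∀ i, iteratedDeriv i ρ δ = 0)
    (hρb : ∀ i, ∀ t ∈ Icc 0 δ, |iteratedDeriv i ρ t| ≤ (ε / 4) ^ i * (2 * i).factorial) :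
    ∀ x ∈ Icc (-1 : ℝ) 0, |∫ t in (0 : ℝ)..δ, ρ t * ψ t x| ≤
      4 * ((1 + |b|) * ∫ t in (0 : ℝ)..δ, |ψ t 0|) := by
  have hε0 := hε.1
  set R : ℕ → ℝ → ℝ := fun i => iteratedDeriv i ρ with hR
  have hRc : ∀ i, Continuous (R i) := fun i =>
    hρ.continuous_iteratedDeriv i (by exact_mod_cast le_top)
  have hRd : ∀ i t, HasDerivAt (R i) (R (i + 1) t) t := fun i t => by
    have := (hρ.differentiable_iteratedDeriv i
      (by exact_mod_cast WithTop.coe_lt_top i) t).hasDerivAt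
    simpa [hR, iteratedDeriv_succ] using this
  have hψt := contDiff_deriv_fst hψ
  have hψx := contDiff_deriv_snd hψ
  have cont_slice : ∀ {f : ℝ → ℝ → ℝ}, ContDiff ℝ (⊤ : ℕ∞) (fun p : ℝ × ℝ => f p.1 p.2) →
      ∀ x, Continuous fun t => f t x := fun hf x =>
    hf.continuous.comp (by fun_prop : Continuous fun t : ℝ => (t, x))
  have hψtc : ∀ x, Continuous fun t => deriv (fun s => ψ s x) t := fun x =>
    cont_slice (f := fun t x => deriv (fun s => ψ s x) t) hψt x
  have hparts : ∀ i x, ∫ t in (0 : ℝ)..δ, R i t * deriv (fun s => ψ s x) t =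
      -∫ t in (0 : ℝ)..δ, R (i + 1) t * ψ t x := by
    intro i x
    rw [intervalIntegral.integral_mul_deriv_eq_deriv_mul (u := R i) (v := fun s => ψ s x)
      (fun t _ => hRd i t) (fun t _ => hasDerivAt_fst_of_contDiff hψ t x)
      ((hRc (i + 1)).intervalIntegrable _ _) ((hψtc x).intervalIntegrable _ _)]
    simp [hR, hρ0, hρδ]
  have hderiv : ∀ {f : ℝ → ℝ → ℝ}, ContDiff ℝ (⊤ : ℕ∞) (fun p : ℝ × ℝ => f p.1 p.2) → ∀ i x,
      HasDerivAt (fun x => ∫ t in (0 : ℝ)..δ, R i t * f t x)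
        (∫ t in (0 : ℝ)..δ, R i t * deriv (fun y => f t y) x) x := by
    intro f hf i x
    have hRi : Continuous (fun p : ℝ × ℝ => R i p.2) := (hRc i).comp continuous_snd
    exact hasDerivAt_intervalIntegral_param (F := fun x t => R i t * f t x)
      (F' := fun x t => R i t * deriv (fun y => f t y) x)
      (hRi.mul (hf.continuous.comp continuous_swap))
      (hRi.mul ((contDiff_deriv_snd hf).continuous.comp continuous_swap))
      (fun x t => (hasDerivAt_snd_of_contDiff hf t x).const_mul (R i t)) 0 δ x
  set F : ℕ → ℝ → ℝ := fun i x => ∫ t in (0 : ℝ)..δ, R i t * ψ t x with hF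
  set H : ℕ → ℝ → ℝ := fun i x => ∫ t in (0 : ℝ)..δ, R i t * deriv (fun y => ψ t y) x with hH
  have hFd : ∀ i x, HasDerivAt (F i) (H i x) x := fun i x => hderiv hψ i x
  have hHd : ∀ i, ∀ x ∈ Icc (-1 : ℝ) 0, HasDerivAt (H i) (ε⁻¹ * F (i + 1) x) x := by
    intro i x hx
    refine (hderiv (f := fun t x => deriv (fun y => ψ t y) x) hψx i x).congr_deriv ?_
    have h1 : ∫ t in (0 : ℝ)..δ, R i t * deriv (deriv (fun y => ψ t y)) x =
        ∫ t in (0 : ℝ)..δ, (-ε⁻¹) * (R i t * deriv (fun s => ψ s x) t) := by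
      refine intervalIntegral.integral_congr fun t ht => ?_
      rw [uIcc_of_le hδ.le] at ht
      have := hpde t ht x hx
      have h2 : deriv (fun s => ψ s x) t = -(ε * deriv (deriv (fun y => ψ t y)) x) := by linarith
      simp only [h2]
      field_simp
    refine h1.trans ?_
    rw [intervalIntegral.integral_const_mul, hparts]
    ring
  obtain ⟨K, hK⟩ := (isCompact_Icc.prod isCompact_Icc :
    IsCompact (Icc 0 δ ×ˢ Icc (-1 : ℝ) 0)).exists_bound_of_continuousOn hψ.continuous.continuousOn
  have hK0 : 0 ≤ K := (norm_nonneg _).trans (hK (0, 0) ⟨by simp [hδ.le], by simp⟩)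
  have hFK : ∀ i, ∀ x ∈ Icc (-1 : ℝ) 0,
      |F i x| ≤ (ε / 4) ^ i * (2 * i).factorial * K * δ := by
    intro i x hx
    have := intervalIntegral.norm_integral_le_of_norm_le_const (a := 0) (b := δ)
      (f := fun t => R i t * ψ t x) (C := (ε / 4) ^ i * (2 * i).factorial * K) (fun t ht => by
        rw [uIoc_of_le hδ.le] at ht
        rw [norm_mul]
        exact mul_le_mul (hρb i t (Ioc_subset_Icc_self ht)) (hK (t, x) ⟨Ioc_subset_Icc_self ht, hx⟩)
          (norm_nonneg _) (by positivity))
    rwa [sub_zero, abs_of_pos hδ] at this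
  set I := ∫ t in (0 : ℝ)..δ, |ψ t 0| with hI
  have hI0 : 0 ≤ I := intervalIntegral.integral_nonneg hδ.le fun _ _ => abs_nonneg _
  have hF0 : ∀ i, |F i 0| ≤ (ε / 4) ^ i * (2 * i).factorial * I := by
    intro i
    rw [hI, ← intervalIntegral.integral_const_mul]
    refine (intervalIntegral.abs_integral_le_integral_abs hδ.le).trans ?_
    refine intervalIntegral.integral_mono_on hδ.le ?_ ?_ fun t ht => ?_
    · exact ((hRc i).mul (cont_slice hψ 0)).abs.intervalIntegrable _ _
    · exact (continuous_const.mul (cont_slice hψ 0).abs).intervalIntegrable _ _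
    · rw [abs_mul]
      exact mul_le_mul_of_nonneg_right (hρb i t ht) (abs_nonneg _)
  have hH0 : ∀ i, H i 0 = -F (i + 1) 0 + b * F i 0 := by
    intro i
    have h1 : H i 0 = ∫ t in (0 : ℝ)..δ,
        (R i t * deriv (fun s => ψ s 0) t + b * (R i t * ψ t 0)) := by
      refine intervalIntegral.integral_congr fun t ht => ?_
      rw [uIcc_of_le hδ.le] at ht
      simp only [hbc t ht]
      ring
    have hi1 : Continuous fun t => R i t * deriv (fun s => ψ s 0) t := (hRc i).mul (hψtc 0)
    have hi2 : Continuous fun t => b * (R i t * ψ t 0) :=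
      continuous_const.mul ((hRc i).mul (cont_slice hψ 0))
    rw [h1, intervalIntegral.integral_add (hi1.intervalIntegrable _ _)
      (hi2.intervalIntegrable _ _),
      intervalIntegral.integral_const_mul, hparts]
  have hneg : ∀ y ∈ Icc (0 : ℝ) 1, -y ∈ Icc (-1 : ℝ) 0 := fun y hy =>
    ⟨by linarith [hy.2], by linarith [hy.1]⟩
  have hpow : ∀ i : ℕ, ε⁻¹ ^ i * (ε / 4) ^ i = (1 / 4) ^ i := fun i => by
    rw [← mul_pow]; congr 1; field_simp
  have hq : ∀ i : ℕ, (1 / 4 : ℝ) ^ i ≤ (1 / 2) ^ i := fun i => by gcongr; norm_num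
  have key := abs_le_of_alternating_tower (A := fun i y => ε⁻¹ ^ i * F i (-y))
    (B := fun i y => -(ε⁻¹ ^ i * H i (-y))) (D := (1 + |b|) * I) (K := K * δ) ?_ ?_ ?_ ?_ ?_
  · intro x hx
    have := key (-x) ⟨by linarith [hx.2], by linarith [hx.1]⟩
    simpa [hF, hR] using this
  · intro i y _
    refine (((hFd i (-y)).scomp y (hasDerivAt_neg y)).const_mul (ε⁻¹ ^ i)).congr_deriv ?_
    simp
  · intro i y hy
    refine (((hHd i (-y) (hneg y hy)).scomp y (hasDerivAt_neg y)).const_mul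
      (ε⁻¹ ^ i)).neg.congr_deriv ?_
    simp only [smul_eq_mul, pow_succ]
    ring
  · intro i
    simp only [neg_zero, abs_mul, abs_pow, abs_inv, abs_of_pos hε0]
    calc ε⁻¹ ^ i * |F i 0| ≤ ε⁻¹ ^ i * ((ε / 4) ^ i * (2 * i).factorial * I) := by
          gcongr; exact hF0 i
      _ = (1 / 4) ^ i * (1 * I) * (2 * i).factorial := by rw [← hpow]; ring
      _ ≤ (1 / 2) ^ i * ((1 + |b|) * I) * (2 * i).factorial := by
          gcongr
          · norm_num
          · linarith [abs_nonneg b]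
      _ = _ := by ring
  · intro i
    simp only [neg_zero, abs_neg, abs_mul, abs_pow, abs_inv, abs_of_pos hε0]
    have hfac : ((2 * i).factorial : ℝ) ≤ (2 * i + 1).factorial := by
      exact_mod_cast Nat.factorial_le (by omega)
    have hfac2 : ((2 * (i + 1)).factorial : ℝ) = 2 * (i + 1) * (2 * i + 1).factorial := by
      rw [show 2 * (i + 1) = (2 * i + 1) + 1 by ring, Nat.factorial_succ]
      push_cast; ring
    have h1 : |H i 0| ≤ (ε / 4) ^ (i + 1) * (2 * (i + 1)).factorial * I +
        |b| * ((ε / 4) ^ i * (2 * i).factorial * I) := by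
      rw [hH0]
      refine (abs_add_le _ _).trans ?_
      rw [abs_neg, abs_mul]
      gcongr
      · exact hF0 _
      · exact hF0 _
    have h2 := add_one_mul_quarter_pow_le i
    calc ε⁻¹ ^ i * |H i 0| ≤ ε⁻¹ ^ i * ((ε / 4) ^ (i + 1) * (2 * (i + 1)).factorial * I +
          |b| * ((ε / 4) ^ i * (2 * i).factorial * I)) := by gcongr
      _ = (1 / 4) ^ i * (ε / 2 * (i + 1) * (2 * i + 1).factorial * I +
          |b| * ((2 * i).factorial * I)) := by rw [← hpow, hfac2]; ring
      _ ≤ (1 / 4) ^ i * (1 * (i + 1) * (2 * i + 1).factorial * I +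
          |b| * ((2 * i + 1).factorial * I)) := by
          gcongr
          linarith [hε.2]
      _ = ((i + 1) * (1 / 4) ^ i + |b| * (1 / 4) ^ i) * I * (2 * i + 1).factorial := by ring
      _ ≤ ((1 / 2) ^ i + |b| * (1 / 2) ^ i) * I * (2 * i + 1).factorial := by
          gcongr
          norm_num
      _ = _ := by ring
  · intro i y hy
    simp only [abs_mul, abs_pow, abs_inv, abs_of_pos hε0]
    calc ε⁻¹ ^ i * |F i (-y)| ≤ ε⁻¹ ^ i * ((ε / 4) ^ i * (2 * i).factorial * K * δ) := by
          gcongr; exact hFK i _ (hneg y hy)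
      _ = _ := by rw [← hpow]; ring

/-! ### The symmetric structure of the adjoint system -/

/-- The symmetric bilinear form for which the generator of the adjoint system is self-adjoint. -/
def weightedPairing (ε : ℝ) (p q : ℝ → ℝ) : ℝ :=
  (∫ x in (-1 : ℝ)..0, Real.exp (x / ε) * (p x * q x)) +
    ε * (p 0 * q 0 + Real.exp (-1 / ε) * (p (-1) * q (-1)))

lemma weightedPairing_comm (ε : ℝ) (p q : ℝ → ℝ) :
    weightedPairing ε p q = weightedPairing ε q p := by
  simp only [weightedPairing, mul_comm (p _)]

lemma weightedPairing_self_nonneg {ε : ℝ} (hε : 0 < ε) (p : ℝ → ℝ) :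
    0 ≤ weightedPairing ε p p := by
  unfold weightedPairing
  have h : 0 ≤ ∫ x in (-1 : ℝ)..0, Real.exp (x / ε) * (p x * p x) :=
    intervalIntegral.integral_nonneg (by norm_num) fun x _ =>
      mul_nonneg (Real.exp_pos _).le (mul_self_nonneg _)
  have h1 := mul_self_nonneg (p 0)
  have h2 := mul_self_nonneg (p (-1))
  positivity

lemma IsAdjSol1D.closed {T ε a : ℝ} {φ : ℝ → ℝ → ℝ} (h : IsAdjSol1D T ε a φ) (hT : 0 < T) :
    (∀ t ∈ Icc 0 T, ∀ x ∈ Icc (-1 : ℝ) 0,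
      deriv (fun s => φ s x) t + deriv (fun y => φ t y) x
        + ε * deriv (deriv (fun y => φ t y)) x - a * φ t x = 0) ∧
    (∀ t ∈ Icc 0 T,
      ε * (deriv (fun s => φ s 0) t - deriv (fun y => φ t y) 0) - φ t 0 = 0) ∧
    (∀ t ∈ Icc 0 T, deriv (fun s => φ s (-1)) t + deriv (fun y => φ t y) (-1) = 0) := by
  obtain ⟨hs, h1, h2, h3⟩ := h
  have ht := (contDiff_deriv_fst hs).continuous
  have hx := (contDiff_deriv_snd hs).continuous
  have hxx := (contDiff_deriv_snd (f := fun t x => deriv (fun y => φ t y) x)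
    (contDiff_deriv_snd hs)).continuous
  have hslice : ∀ x : ℝ, Continuous fun t : ℝ => (t, x) := fun x => by fun_prop
  have hcl : closure (Ioo 0 T) = Icc 0 T := closure_Ioo hT.ne
  refine ⟨fun t htm x hxm => ?_, fun t htm => ?_, fun t htm => ?_⟩
  · have : EqOn (fun p : ℝ × ℝ => deriv (fun s => φ s p.2) p.1 + deriv (fun y => φ p.1 y) p.2
        + ε * deriv (deriv (fun y => φ p.1 y)) p.2 - a * φ p.1 p.2) (fun _ => 0)
        (closure (Ioo 0 T ×ˢ Ioo (-1 : ℝ) 0)) :=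
      EqOn.closure (fun p hp => h1 p.1 hp.1 p.2 hp.2)
        (((ht.add hx).add (continuous_const.mul hxx)).sub (continuous_const.mul hs.continuous))
        continuous_const
    rw [closure_prod_eq, hcl, closure_Ioo (by norm_num)] at this
    exact this (x := (t, x)) ⟨htm, hxm⟩
  · have : EqOn (fun t => ε * (deriv (fun s => φ s 0) t - deriv (fun y => φ t y) 0) - φ t 0)
        (fun _ => 0) (closure (Ioo 0 T)) :=
      EqOn.closure h2 ((continuous_const.mul ((ht.comp (hslice 0)).sub (hx.comp (hslice 0)))).sub
        (hs.continuous.comp (hslice 0))) continuous_const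
    rw [hcl] at this
    exact this htm
  · have : EqOn (fun t => deriv (fun s => φ s (-1)) t + deriv (fun y => φ t y) (-1))
        (fun _ => 0) (closure (Ioo 0 T)) :=
      EqOn.closure h3 ((ht.comp (hslice (-1))).add (hx.comp (hslice (-1)))) continuous_const
    rw [hcl] at this
    exact this htm

/-- Green's formula: the generator is symmetric and non-negative. -/
lemma weightedPairing_generator {ε a : ℝ} (hε : 0 < ε) {p v q : ℝ → ℝ}
    (hp : ContDiff ℝ (⊤ : ℕ∞) p) (hq : ContDiff ℝ (⊤ : ℕ∞) q)
    (hpde : ∀ x ∈ Icc (-1 : ℝ) 0, v x + deriv p x + ε * deriv (deriv p) x - a * p x = 0)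
    (hr : ε * (v 0 - deriv p 0) - p 0 = 0) (hl : v (-1) + deriv p (-1) = 0) :
    weightedPairing ε v q =
      (∫ x in (-1 : ℝ)..0, Real.exp (x / ε) * (ε * (deriv p x * deriv q x) + a * (p x * q x)))
        + p 0 * q 0 := by
  have hp1 : ContDiff ℝ (⊤ : ℕ∞) (deriv p) := (contDiff_infty_iff_deriv.1 hp).2
  have hp2 : ContDiff ℝ (⊤ : ℕ∞) (deriv (deriv p)) := (contDiff_infty_iff_deriv.1 hp1).2
  have hq1 : ContDiff ℝ (⊤ : ℕ∞) (deriv q) := (contDiff_infty_iff_deriv.1 hq).2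
  have cp := hp.continuous
  have cp1 := hp1.continuous
  have cp2 := hp2.continuous
  have cq := hq.continuous
  have cq1 := hq1.continuous
  have hexp : ∀ x : ℝ, HasDerivAt (fun x => Real.exp (x / ε)) (Real.exp (x / ε) * (1 / ε)) x :=
    fun x => ((hasDerivAt_id x).div_const ε).exp
  have hd : ∀ x, HasDerivAt (fun x => ε * (Real.exp (x / ε) * (deriv p x * q x)))
      (Real.exp (x / ε) * (deriv p x * q x + ε * deriv (deriv p) x * q x +
        ε * (deriv p x * deriv q x))) x := fun x => by
    refine ((hexp x).mul (((hp1.differentiable (by simp) x).hasDerivAt).mul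
      ((hq.differentiable (by simp) x).hasDerivAt)) |>.const_mul ε).congr_deriv ?_
    simp only [Pi.mul_apply]
    field_simp
    ring
  have hftc := intervalIntegral.integral_eq_sub_of_hasDerivAt (a := -1) (b := 0)
    (fun x _ => hd x) (Continuous.intervalIntegrable (by fun_prop) _ _)
  have hsplit : ∫ x in (-1 : ℝ)..0, Real.exp (x / ε) * (v x * q x) =
      (∫ x in (-1 : ℝ)..0,
        Real.exp (x / ε) * (ε * (deriv p x * deriv q x) + a * (p x * q x))) -
      ∫ x in (-1 : ℝ)..0, Real.exp (x / ε) * (deriv p x * q x + ε * deriv (deriv p) x * q x +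
        ε * (deriv p x * deriv q x)) := by
    rw [← intervalIntegral.integral_sub (Continuous.intervalIntegrable (by fun_prop) _ _)
      (Continuous.intervalIntegrable (by fun_prop) _ _)]
    refine intervalIntegral.integral_congr fun x hx => ?_
    rw [uIcc_of_le (by norm_num)] at hx
    have : v x = a * p x - deriv p x - ε * deriv (deriv p) x := by linarith [hpde x hx]
    simp only [this]
    ring
  unfold weightedPairing
  rw [hsplit, hftc]
  have hl' : v (-1) = -deriv p (-1) := by linarith
  have hr' : ε * v 0 = ε * deriv p 0 + p 0 := by linarith
  rw [hl', zero_div, Real.exp_zero]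
  linear_combination q 0 * hr'

lemma hasDerivAt_weightedPairing {ε : ℝ} {φ χ : ℝ → ℝ → ℝ}
    (hφ : ContDiff ℝ (⊤ : ℕ∞) (fun p : ℝ × ℝ => φ p.1 p.2))
    (hχ : ContDiff ℝ (⊤ : ℕ∞) (fun p : ℝ × ℝ => χ p.1 p.2)) (t : ℝ) :
    HasDerivAt (fun s => weightedPairing ε (φ s) (χ s))
      (weightedPairing ε (fun x => deriv (fun s => φ s x) t) (χ t) +
        weightedPairing ε (φ t) (fun x => deriv (fun s => χ s x) t)) t := by
  have cφ := hφ.continuous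
  have cχ := hχ.continuous
  have cφt := (contDiff_deriv_fst hφ).continuous
  have cχt := (contDiff_deriv_fst hχ).continuous
  have dφ := hasDerivAt_fst_of_contDiff hφ
  have dχ := hasDerivAt_fst_of_contDiff hχ
  have cw : Continuous fun p : ℝ × ℝ => Real.exp (p.2 / ε) := by fun_prop
  have hslice : Continuous fun x : ℝ => (t, x) := by fun_prop
  have cw1 : Continuous fun x : ℝ => Real.exp (x / ε) := by fun_prop
  have h1 := hasDerivAt_intervalIntegral_param
    (F := fun s x => Real.exp (x / ε) * (φ s x * χ s x))
    (F' := fun t x => Real.exp (x / ε) *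
      (deriv (fun s => φ s x) t * χ t x + φ t x * deriv (fun s => χ s x) t))
    (cw.mul (cφ.mul cχ)) (cw.mul ((cφt.mul cχ).add (cφ.mul cχt)))
    (fun t x => ((dφ t x).mul (dχ t x)).const_mul _) (-1) 0 t
  have h2 := ((dφ t 0).mul (dχ t 0)).add
    (((dφ t (-1)).mul (dχ t (-1))).const_mul (Real.exp (-1 / ε)))
  refine (h1.add (h2.const_mul ε)).congr_deriv ?_
  unfold weightedPairing
  have i1 : Continuous fun x => Real.exp (x / ε) * (deriv (fun s => φ s x) t * χ t x) :=
    cw1.mul ((cφt.comp hslice).mul (cχ.comp hslice))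
  have i2 : Continuous fun x => Real.exp (x / ε) * (φ t x * deriv (fun s => χ s x) t) :=
    cw1.mul ((cφ.comp hslice).mul (cχt.comp hslice))
  simp only [mul_add]
  rw [intervalIntegral.integral_add (i1.intervalIntegrable _ _) (i2.intervalIntegrable _ _)]
  ring

section Symmetry

variable {δ ε a : ℝ} {φ : ℝ → ℝ → ℝ}

lemma IsAdjSol1D.weightedPairing_deriv (h : IsAdjSol1D δ ε a φ) (hδ : 0 < δ) (hε : 0 < ε)
    {t : ℝ} (ht : t ∈ Icc 0 δ) (r : ℝ) :
    weightedPairing ε (fun x => deriv (fun s => φ s x) t) (φ r) =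
      (∫ x in (-1 : ℝ)..0, Real.exp (x / ε) *
        (ε * (deriv (φ t) x * deriv (φ r) x) + a * (φ t x * φ r x))) + φ t 0 * φ r 0 := by
  obtain ⟨h1, h2, h3⟩ := h.closed hδ
  have hs : ∀ t, ContDiff ℝ (⊤ : ℕ∞) (φ t) := fun t =>
    h.1.comp (contDiff_const.prodMk contDiff_id)
  exact weightedPairing_generator hε (hs t) (hs r) (h1 t ht) (h2 t ht) (h3 t ht)

lemma IsAdjSol1D.weightedPairing_deriv_comm (h : IsAdjSol1D δ ε a φ) (hδ : 0 < δ) (hε : 0 < ε)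
    {t r : ℝ} (ht : t ∈ Icc 0 δ) (hr : r ∈ Icc 0 δ) :
    weightedPairing ε (fun x => deriv (fun s => φ s x) t) (φ r) =
      weightedPairing ε (φ t) (fun x => deriv (fun s => φ s x) r) := by
  rw [weightedPairing_comm ε (φ t), h.weightedPairing_deriv hδ hε ht,
    h.weightedPairing_deriv hδ hε hr]
  simp only [mul_comm]

lemma IsAdjSol1D.weightedPairing_zero_right (h : IsAdjSol1D δ ε a φ) (hδ : 0 < δ) (hε : 0 < ε)
    {t : ℝ} (ht : t ∈ Icc 0 δ) :
    weightedPairing ε (φ t) (φ 0) = weightedPairing ε (φ (t / 2)) (φ (t / 2)) := by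
  have hφ := h.1
  have hχ : ContDiff ℝ (⊤ : ℕ∞) (fun p : ℝ × ℝ => φ (t - p.1) p.2) :=
    hφ.comp ((contDiff_const.sub contDiff_fst).prodMk contDiff_snd)
  have hχd : ∀ u x, deriv (fun s => φ (t - s) x) u = -deriv (fun s => φ s x) (t - u) := fun u x =>
    deriv_comp_const_sub (f := fun s => φ s x) t u
  have hd : ∀ u ∈ Icc 0 t,
      HasDerivAt (fun u => weightedPairing ε (φ u) (φ (t - u))) 0 u := fun u hu => by
    refine (hasDerivAt_weightedPairing (χ := fun u => φ (t - u)) hφ hχ u).congr_deriv ?_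
    have hneg : weightedPairing ε (φ u) (fun x => deriv (fun s => φ (t - s) x) u) =
        -weightedPairing ε (φ u) (fun x => deriv (fun s => φ s x) (t - u)) := by
      simp only [hχd, weightedPairing, mul_neg, intervalIntegral.integral_neg]
      ring
    rw [hneg, h.weightedPairing_deriv_comm hδ hε ⟨hu.1, hu.2.trans ht.2⟩
      ⟨by linarith [hu.2], by linarith [hu.1, ht.2]⟩]
    ring
  have hc := constant_of_has_deriv_right_zero
    (fun u hu => (hd u hu).continuousAt.continuousWithinAt)
    (fun u hu => (hd u (Ico_subset_Icc_self hu)).hasDerivWithinAt)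
  have e1 := hc t ⟨ht.1, le_refl t⟩
  have e2 := hc (t / 2) ⟨by linarith [ht.1], by linarith [ht.1]⟩
  simp only [sub_self] at e1
  rw [e1, ← e2]
  congr 2
  ring

lemma IsAdjSol1D.weightedPairing_self_le (h : IsAdjSol1D δ ε a φ) (hδ : 0 < δ) (hε : 0 < ε)
    (ha : 0 ≤ a) {t : ℝ} (ht : t ∈ Icc 0 δ) :
    weightedPairing ε (φ 0) (φ 0) ≤ weightedPairing ε (φ t) (φ t) := by
  have hd := hasDerivAt_weightedPairing (ε := ε) h.1 h.1
  refine monotoneOn_of_deriv_nonneg (f := fun t => weightedPairing ε (φ t) (φ t))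
    (convex_Icc 0 δ) (fun u _ => (hd u).continuousAt.continuousWithinAt)
    (fun u _ => (hd u).differentiableAt.differentiableWithinAt) (fun u hu => ?_)
    ⟨le_rfl, hδ.le⟩ ht ht.1
  rw [interior_Icc] at hu
  have hu' := Ioo_subset_Icc_self hu
  rw [(hd u).deriv, ← h.weightedPairing_deriv_comm hδ hε hu' hu', h.weightedPairing_deriv hδ hε hu']
  have : 0 ≤ ∫ x in (-1 : ℝ)..0, Real.exp (x / ε) *
      (ε * (deriv (φ u) x * deriv (φ u) x) + a * (φ u x * φ u x)) :=
    intervalIntegral.integral_nonneg (by norm_num) fun x _ => by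
      have h1 := mul_self_nonneg (deriv (φ u) x)
      have h2 := mul_self_nonneg (φ u x)
      positivity
  linarith [mul_self_nonneg (φ u 0)]

/-- Averaging in time against a non-negative kernel does not decrease the energy. -/
lemma IsAdjSol1D.sq_integral_mul_le_weightedPairing_average (h : IsAdjSol1D δ ε a φ) (hδ : 0 < δ)
    (hε : 0 < ε) (ha : 0 ≤ a) {σ : ℝ → ℝ} (hσ : Continuous σ) (hσ0 : ∀ t, 0 ≤ σ t) :
    (∫ t in (0 : ℝ)..δ, σ t) ^ 2 * weightedPairing ε (φ 0) (φ 0) ≤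
      weightedPairing ε (fun x => ∫ t in (0 : ℝ)..δ, σ t * φ t x)
        (fun x => ∫ t in (0 : ℝ)..δ, σ t * φ t x) := by
  set F : ℝ → ℝ := fun x => ∫ t in (0 : ℝ)..δ, σ t * φ t x with hF
  set l := ∫ t in (0 : ℝ)..δ, σ t with hl
  have cφ := h.1.continuous
  have cslice : ∀ t, Continuous (φ t) := fun t =>
    cφ.comp (by fun_prop : Continuous fun x : ℝ => (t, x))
  have cslice' : ∀ x, Continuous fun t => φ t x := fun x =>
    cφ.comp (by fun_prop : Continuous fun t : ℝ => (t, x))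
  have cF : Continuous F := by
    refine intervalIntegral.continuous_parametric_intervalIntegral_of_continuous'
      (f := fun x t => σ t * φ t x) ?_ 0 δ
    exact (hσ.comp continuous_snd).mul (cφ.comp continuous_swap)
  have hpair : weightedPairing ε F (φ 0) = ∫ t in (0 : ℝ)..δ, σ t * weightedPairing ε (φ t) (φ 0) := by
    have c1 : Continuous fun t => ∫ x in (-1 : ℝ)..0,
        Real.exp (x / ε) * (φ t x * φ 0 x) := by
      refine intervalIntegral.continuous_parametric_intervalIntegral_of_continuous'
        (f := fun t x => Real.exp (x / ε) * (φ t x * φ 0 x)) ?_ (-1) 0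
      exact (by fun_prop : Continuous fun p : ℝ × ℝ => Real.exp (p.2 / ε)).mul
        (cφ.mul ((cslice 0).comp continuous_snd))
    have hswap : ∫ x in (-1 : ℝ)..0, Real.exp (x / ε) * (F x * φ 0 x) =
        ∫ t in (0 : ℝ)..δ, σ t * ∫ x in (-1 : ℝ)..0, Real.exp (x / ε) * (φ t x * φ 0 x) := by
      have : ∀ x, Real.exp (x / ε) * (F x * φ 0 x) =
          ∫ t in (0 : ℝ)..δ, σ t * (Real.exp (x / ε) * (φ t x * φ 0 x)) := fun x => by
        rw [hF, ← intervalIntegral.integral_mul_const, ← intervalIntegral.integral_const_mul]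
        exact intervalIntegral.integral_congr fun t _ => by ring
      simp only [this]
      rw [integral_integral_swap_of_continuous
        (F := fun x t => σ t * (Real.exp (x / ε) * (φ t x * φ 0 x)))]
      · simp only [intervalIntegral.integral_const_mul]
      · exact (hσ.comp continuous_snd).mul
          ((by fun_prop : Continuous fun p : ℝ × ℝ => Real.exp (p.1 / ε)).mul
          ((cφ.comp continuous_swap).mul ((cslice 0).comp continuous_fst)))
    have e0 : ∀ x, F x * φ 0 x = ∫ t in (0 : ℝ)..δ, σ t * (φ t x * φ 0 x) := fun x => by
      rw [hF, ← intervalIntegral.integral_mul_const]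
      exact intervalIntegral.integral_congr fun t _ => by ring
    have hc : ∀ x, IntervalIntegrable (fun t => σ t * (φ t x * φ 0 x)) volume 0 δ := fun x =>
      (hσ.mul ((cslice' x).mul continuous_const)).intervalIntegrable _ _
    have : ∀ t, σ t * weightedPairing ε (φ t) (φ 0) =
        (σ t * ∫ x in (-1 : ℝ)..0, Real.exp (x / ε) * (φ t x * φ 0 x)) +
        (ε * (σ t * (φ t 0 * φ 0 0)) + ε * Real.exp (-1 / ε) *
          (σ t * (φ t (-1) * φ 0 (-1)))) := fun t => by
      unfold weightedPairing; ring
    simp only [this]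
    have c2 : Continuous fun t => σ t * ∫ x in (-1 : ℝ)..0,
        Real.exp (x / ε) * (φ t x * φ 0 x) := hσ.mul c1
    rw [intervalIntegral.integral_add (c2.intervalIntegrable _ _)
      (((hc 0).const_mul _).add ((hc (-1)).const_mul _)),
      intervalIntegral.integral_add ((hc 0).const_mul _) ((hc (-1)).const_mul _),
      intervalIntegral.integral_const_mul, intervalIntegral.integral_const_mul,
      ← e0, ← e0, ← hswap]
    unfold weightedPairing
    ring
  have hlow : l * weightedPairing ε (φ 0) (φ 0) ≤ weightedPairing ε F (φ 0) := by
    rw [hpair, hl, ← intervalIntegral.integral_mul_const]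
    have cN : Continuous fun t => weightedPairing ε (φ t) (φ 0) := by
      have h0 : ContDiff ℝ (⊤ : ℕ∞) (fun p : ℝ × ℝ => φ 0 p.2) :=
        h.1.comp (contDiff_const.prodMk contDiff_snd)
      exact continuous_iff_continuousAt.2 fun t =>
        (hasDerivAt_weightedPairing (χ := fun _ => φ 0) h.1 h0 t).continuousAt
    refine intervalIntegral.integral_mono_on hδ.le ?_ ?_ fun t ht => ?_
    · exact (hσ.mul continuous_const).intervalIntegrable _ _
    · exact (hσ.mul cN).intervalIntegrable _ _
    · rw [h.weightedPairing_zero_right hδ hε ht]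
      exact mul_le_mul_of_nonneg_left (h.weightedPairing_self_le hδ hε ha
        ⟨by linarith [ht.1], by linarith [ht.1, ht.2]⟩) (hσ0 t)
  have hl0 : 0 ≤ l := intervalIntegral.integral_nonneg hδ.le fun t _ => hσ0 t
  have hexpand : weightedPairing ε (fun x => F x - l * φ 0 x) (fun x => F x - l * φ 0 x) =
      weightedPairing ε F F - 2 * l * weightedPairing ε F (φ 0) +
        l ^ 2 * weightedPairing ε (φ 0) (φ 0) := by
    have cw : Continuous fun x : ℝ => Real.exp (x / ε) := by fun_prop
    have i1 : IntervalIntegrable (fun x => Real.exp (x / ε) * (F x * F x)) volume (-1) 0 :=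
      (cw.mul (cF.mul cF)).intervalIntegrable _ _
    have i2 : IntervalIntegrable (fun x => Real.exp (x / ε) * (F x * φ 0 x)) volume (-1) 0 :=
      (cw.mul (cF.mul (cslice 0))).intervalIntegrable _ _
    have i3 : IntervalIntegrable (fun x => Real.exp (x / ε) * (φ 0 x * φ 0 x)) volume (-1) 0 :=
      (cw.mul ((cslice 0).mul (cslice 0))).intervalIntegrable _ _
    have e : ∫ x in (-1 : ℝ)..0, Real.exp (x / ε) * ((F x - l * φ 0 x) * (F x - l * φ 0 x)) =
        ∫ x in (-1 : ℝ)..0, (Real.exp (x / ε) * (F x * F x) -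
          2 * l * (Real.exp (x / ε) * (F x * φ 0 x)) +
          l ^ 2 * (Real.exp (x / ε) * (φ 0 x * φ 0 x))) :=
      intervalIntegral.integral_congr fun x _ => by ring
    unfold weightedPairing
    rw [e, intervalIntegral.integral_add (i1.sub (i2.const_mul _)) (i3.const_mul _),
      intervalIntegral.integral_sub i1 (i2.const_mul _), intervalIntegral.integral_const_mul,
      intervalIntegral.integral_const_mul]
    ring
  have hpos := weightedPairing_self_nonneg hε (fun x => F x - l * φ 0 x)
  rw [hexpand] at hpos
  have := mul_le_mul_of_nonneg_left hlow hl0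
  linarith

end Symmetry

/-! ### Observability on a short window -/

lemma X1normSq_le_weightedPairing {ε : ℝ} (hε : 0 < ε) {p : ℝ → ℝ} (hp : Continuous p) :
    X1normSq ε p ≤ Real.exp (1 / ε) * weightedPairing ε p p := by
  have hexp : ∀ x : ℝ, Real.exp (1 / ε) * Real.exp (x / ε) = Real.exp ((1 + x) / ε) := fun x => by
    rw [← Real.exp_add, add_div]
  have h1 : ∫ x in (-1 : ℝ)..0, p x ^ 2 ≤
      Real.exp (1 / ε) * ∫ x in (-1 : ℝ)..0, Real.exp (x / ε) * (p x * p x) := by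
    rw [← intervalIntegral.integral_const_mul]
    refine intervalIntegral.integral_mono_on (by norm_num)
      (Continuous.intervalIntegrable (by fun_prop) _ _)
      (Continuous.intervalIntegrable (by fun_prop) _ _) fun x hx => ?_
    rw [← mul_assoc, hexp, sq]
    exact le_mul_of_one_le_left (mul_self_nonneg _)
      (Real.one_le_exp (div_nonneg (by linarith [hx.1]) hε.le))
  have h2 : Real.exp (1 / ε) * Real.exp (-1 / ε) = 1 := by rw [hexp]; simp
  have h3 : p 0 ^ 2 ≤ Real.exp (1 / ε) * p 0 ^ 2 :=
    le_mul_of_one_le_left (sq_nonneg _) (Real.one_le_exp (by positivity))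
  unfold X1normSq weightedPairing
  calc _ ≤ Real.exp (1 / ε) * (∫ x in (-1 : ℝ)..0, Real.exp (x / ε) * (p x * p x)) +
        ε * (Real.exp (1 / ε) * p 0 ^ 2 + p (-1) ^ 2) := by gcongr
    _ = _ := by linear_combination (-ε * p (-1) ^ 2) * h2

lemma weightedPairing_self_le_of_abs_le {ε S : ℝ} (hε : ε ∈ Ioo (0 : ℝ) 1) {F : ℝ → ℝ}
    (hF : Continuous F) (hS : ∀ x ∈ Icc (-1 : ℝ) 0, |Real.exp (x / (2 * ε)) * F x| ≤ S) :
    weightedPairing ε F F ≤ 3 * S ^ 2 := by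
  have hε0 := hε.1
  have hsq : ∀ x ∈ Icc (-1 : ℝ) 0, Real.exp (x / ε) * (F x * F x) ≤ S ^ 2 := fun x hx => by
    have h1 : Real.exp (x / ε) = Real.exp (x / (2 * ε)) ^ 2 := by
      rw [← Real.exp_nat_mul]; congr 1; push_cast; field_simp
    calc Real.exp (x / ε) * (F x * F x) = |Real.exp (x / (2 * ε)) * F x| ^ 2 := by
          rw [sq_abs, h1]; ring
      _ ≤ S ^ 2 := by gcongr; exact hS x hx
  have h0 := hsq 0 (by simp)
  have h1 := hsq (-1) (by simp)
  have hint : ∫ x in (-1 : ℝ)..0, Real.exp (x / ε) * (F x * F x) ≤ S ^ 2 := by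
    have := intervalIntegral.integral_mono_on (μ := volume) (a := -1) (b := 0) (by norm_num)
      (Continuous.intervalIntegrable (by fun_prop) _ _) intervalIntegrable_const hsq
    simpa using this
  rw [zero_div, Real.exp_zero, one_mul] at h0
  unfold weightedPairing
  have h2 : ε * (F 0 * F 0 + Real.exp (-1 / ε) * (F (-1) * F (-1))) ≤ 1 * (S ^ 2 + S ^ 2) := by
    refine mul_le_mul hε.2.le (add_le_add h0 h1) (add_nonneg (mul_self_nonneg _) ?_) zero_le_one
    exact mul_nonneg (Real.exp_pos _).le (mul_self_nonneg _)
  linarith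

lemma IsAdjSol1D.abs_average_le {δ ε a : ℝ} {φ : ℝ → ℝ → ℝ} {ρ : ℝ → ℝ} (h : IsAdjSol1D δ ε a φ)
    (hδ : 0 < δ) (hε : ε ∈ Ioo (0 : ℝ) 1) (ha : 0 ≤ a) (hρ : ContDiff ℝ (⊤ : ℕ∞) ρ)
    (hρ0 : ∀ i, iteratedDeriv i ρ 0 = 0) (hρδ : ∀ i, iteratedDeriv i ρ δ = 0)
    (hρb : ∀ i, ∀ t ∈ Icc 0 δ, |iteratedDeriv i ρ t| ≤ (ε / 4) ^ i * (2 * i).factorial) :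
    ∀ x ∈ Icc (-1 : ℝ) 0, |Real.exp (x / (2 * ε)) *
        ∫ t in (0 : ℝ)..δ, ρ t * Real.exp (-((a + 1 / (4 * ε)) * t)) * φ t x| ≤
      4 * ((1 + |a - 1 / (4 * ε)|) * ∫ t in (0 : ℝ)..δ, |φ t 0|) := by
  have hε0 := hε.1
  obtain ⟨h1, h2, -⟩ := h.closed hδ
  have hφ := h.1
  set c := a + 1 / (4 * ε) with hc
  have hc0 : 0 ≤ c := by positivity
  set ψ : ℝ → ℝ → ℝ := fun t x => Real.exp (x / (2 * ε) - c * t) * φ t x with hψdef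
  have hψ : ContDiff ℝ (⊤ : ℕ∞) (fun p : ℝ × ℝ => ψ p.1 p.2) :=
    (Real.contDiff_exp.comp ((contDiff_snd.div_const _).sub (contDiff_const.mul contDiff_fst))).mul hφ
  have dt : ∀ t x, deriv (fun s => ψ s x) t =
      Real.exp (x / (2 * ε) - c * t) * (deriv (fun s => φ s x) t - c * φ t x) := fun t x => by
    have e : HasDerivAt (fun t => Real.exp (x / (2 * ε) - c * t))
        (Real.exp (x / (2 * ε) - c * t) * (-(c * 1))) t :=
      (((hasDerivAt_id t).const_mul c).const_sub _).exp
    refine (e.mul (hasDerivAt_fst_of_contDiff hφ t x)).deriv.trans ?_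
    ring
  have de : ∀ t x, HasDerivAt (fun x => Real.exp (x / (2 * ε) - c * t))
      (Real.exp (x / (2 * ε) - c * t) * (1 / (2 * ε))) x := fun t x =>
    (((hasDerivAt_id x).div_const _).sub_const _).exp
  have dx : ∀ t x, deriv (fun y => ψ t y) x =
      Real.exp (x / (2 * ε) - c * t) * (1 / (2 * ε) * φ t x + deriv (fun y => φ t y) x) :=
    fun t x => by
      refine ((de t x).mul (hasDerivAt_snd_of_contDiff hφ t x)).deriv.trans ?_
      ring
  have dxx : ∀ t x, deriv (deriv (fun y => ψ t y)) x =
      Real.exp (x / (2 * ε) - c * t) * (1 / (2 * ε) * (1 / (2 * ε) * φ t x) +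
        2 * (1 / (2 * ε)) * deriv (fun y => φ t y) x + deriv (deriv (fun y => φ t y)) x) :=
    fun t x => by
      have : deriv (fun y => ψ t y) = fun x => Real.exp (x / (2 * ε) - c * t) *
          (1 / (2 * ε) * φ t x + deriv (fun y => φ t y) x) := funext fun x => dx t x
      rw [this]
      have hx2 := hasDerivAt_snd_of_contDiff (f := fun t x => deriv (fun y => φ t y) x)
        (contDiff_deriv_snd hφ) t x
      have := (de t x).mul (((hasDerivAt_snd_of_contDiff hφ t x).const_mul (1 / (2 * ε))).add hx2)
      refine this.deriv.trans ?_
      simp only [Pi.add_apply]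
      ring
  have key := abs_average_le_of_backward_heat (b := a - 1 / (4 * ε)) hψ hρ hδ hε ?_ ?_ hρ0 hρδ hρb
  · intro x hx
    have e : Real.exp (x / (2 * ε)) * ∫ t in (0 : ℝ)..δ, ρ t * Real.exp (-(c * t)) * φ t x =
        ∫ t in (0 : ℝ)..δ, ρ t * ψ t x := by
      rw [← intervalIntegral.integral_const_mul]
      refine intervalIntegral.integral_congr fun t _ => ?_
      simp only [hψdef, sub_eq_add_neg, Real.exp_add]
      ring
    rw [e]
    refine (key x hx).trans ?_
    have hcont : ∀ {f : ℝ → ℝ → ℝ}, Continuous (fun p : ℝ × ℝ => f p.1 p.2) →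
        Continuous fun t => |f t 0| := fun hf =>
      (hf.comp (by fun_prop : Continuous fun t : ℝ => (t, (0 : ℝ)))).abs
    gcongr 4 * ((1 + |a - 1 / (4 * ε)|) * ?_)
    refine intervalIntegral.integral_mono_on hδ.le ((hcont hψ.continuous).intervalIntegrable _ _)
      ((hcont hφ.continuous).intervalIntegrable _ _) fun t ht => ?_
    rw [hψdef, abs_mul, Real.abs_exp]
    refine mul_le_of_le_one_left (abs_nonneg _) (Real.exp_le_one_iff.2 ?_)
    have := mul_nonneg hc0 ht.1
    simp only [zero_div]
    linarith
  · intro t ht x hx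
    rw [dt, dxx]
    have := h1 t ht x hx
    have h3 : deriv (fun s => φ s x) t = a * φ t x - deriv (fun y => φ t y) x
      - ε * deriv (deriv (fun y => φ t y)) x := by linarith
    rw [h3, hc]
    field_simp
    ring
  · intro t ht
    rw [dt, dx, hψdef]
    have := h2 t ht
    have h3 : deriv (fun s => φ s 0) t = deriv (fun y => φ t y) 0 + φ t 0 / ε := by
      field_simp
      linarith
    rw [h3, hc]
    field_simp
    ring

lemma IsAdjSol1D.weightedPairing_le_window {δ ε a : ℝ} {φ : ℝ → ℝ → ℝ} (h : IsAdjSol1D δ ε a φ)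
    (hδ : 0 < δ) (hε : ε ∈ Ioo (0 : ℝ) 1) (ha : 0 ≤ a) :
    (δ / 3 * Real.exp (-(216 / (ε * δ)) - (a + 1 / (4 * ε)) * δ)) ^ 2 *
        weightedPairing ε (φ 0) (φ 0) ≤
      48 * (1 + |a - 1 / (4 * ε)|) ^ 2 * (δ * ∫ t in (0 : ℝ)..δ, φ t 0 ^ 2) := by
  have hε0 := hε.1
  set c := a + 1 / (4 * ε) with hc
  have hc0 : 0 ≤ c := by positivity
  obtain ⟨ρ, hρ, hρn, hρ0, hρδ, hρb, hρl⟩ := exists_gevrey_bump (κ := 36 / ε) (by positivity) hδ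
  have hκ : 9 / (36 / ε) = ε / 4 := by field_simp; norm_num
  rw [hκ] at hρb
  have hφ := h.1.continuous
  set σ : ℝ → ℝ := fun t => ρ t * Real.exp (-(c * t)) with hσ
  have cρ := hρ.continuous
  have cσ : Continuous σ := by fun_prop
  have hσ0 : ∀ t, 0 ≤ σ t := fun t => mul_nonneg (hρn t) (Real.exp_pos _).le
  have hlow : δ / 3 * Real.exp (-(216 / (ε * δ)) - c * δ) ≤ ∫ t in (0 : ℝ)..δ, σ t := by
    calc δ / 3 * Real.exp (-(216 / (ε * δ)) - c * δ)
        = ∫ _ in (δ / 3)..(2 * δ / 3), Real.exp (-(216 / (ε * δ)) - c * δ) := by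
          rw [intervalIntegral.integral_const, smul_eq_mul]; ring
      _ ≤ ∫ t in (δ / 3)..(2 * δ / 3), σ t := by
          refine intervalIntegral.integral_mono_on (by linarith) intervalIntegrable_const
            (cσ.intervalIntegrable _ _) fun t ht => ?_
          rw [sub_eq_add_neg, Real.exp_add]
          refine mul_le_mul ?_ (Real.exp_le_exp.2 ?_) (Real.exp_pos _).le (hρn t)
          · have : 216 / (ε * δ) = 6 * (36 / ε) / δ := by field_simp; norm_num
            rw [this]
            exact hρl t ht
          · have : c * t ≤ c * δ := by gcongr; linarith [ht.2]
            linarith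
      _ ≤ ∫ t in (0 : ℝ)..δ, σ t := by
          refine intervalIntegral.integral_mono_interval (by linarith) (by linarith) (by linarith)
            (Filter.Eventually.of_forall hσ0) (cσ.intervalIntegrable _ _)
  have hN := weightedPairing_self_nonneg hε0 (φ 0)
  have hF : Continuous fun x => ∫ t in (0 : ℝ)..δ, σ t * φ t x :=
    intervalIntegral.continuous_parametric_intervalIntegral_of_continuous'
      (f := fun x t => σ t * φ t x) ((cσ.comp continuous_snd).mul (hφ.comp continuous_swap)) 0 δ
  have ch : Continuous fun t => |φ t 0| :=
    (hφ.comp (by fun_prop : Continuous fun t : ℝ => (t, (0 : ℝ)))).abs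
  have hcs := sq_integral_le_mul_integral_sq ch hδ
  simp only [sq_abs] at hcs
  calc _ ≤ (∫ t in (0 : ℝ)..δ, σ t) ^ 2 * weightedPairing ε (φ 0) (φ 0) := by gcongr
    _ ≤ _ := h.sq_integral_mul_le_weightedPairing_average hδ hε0 ha cσ hσ0
    _ ≤ 3 * (4 * ((1 + |a - 1 / (4 * ε)|) * ∫ t in (0 : ℝ)..δ, |φ t 0|)) ^ 2 :=
        weightedPairing_self_le_of_abs_le hε hF
          (h.abs_average_le hδ hε ha hρ hρ0 hρδ hρb)
    _ = 48 * (1 + |a - 1 / (4 * ε)|) ^ 2 * (∫ t in (0 : ℝ)..δ, |φ t 0|) ^ 2 := by ring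
    _ ≤ _ := by gcongr

lemma IsAdjSol1D.translate {T δ ε a t₀ : ℝ} {φ : ℝ → ℝ → ℝ} (h : IsAdjSol1D T ε a φ)
    (h0 : 0 ≤ t₀) (h1 : t₀ + δ ≤ T) : IsAdjSol1D δ ε a (fun t => φ (t₀ + t)) := by
  obtain ⟨hs, h2, h3, h4⟩ := h
  have hd : ∀ t x, deriv (fun s => φ (t₀ + s) x) t = deriv (fun s => φ s x) (t₀ + t) := fun t x =>
    deriv_comp_const_add (f := fun s => φ s x) t₀ t
  have hm : ∀ t ∈ Ioo 0 δ, t₀ + t ∈ Ioo 0 T := fun t ht =>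
    ⟨by linarith [ht.1], by linarith [ht.2]⟩
  refine ⟨hs.comp ((contDiff_const.add contDiff_fst).prodMk contDiff_snd),
    fun t ht x hx => ?_, fun t ht => ?_, fun t ht => ?_⟩
  · rw [hd]; exact h2 _ (hm t ht) x hx
  · rw [hd]; exact h3 _ (hm t ht)
  · rw [hd]; exact h4 _ (hm t ht)

/-- Observability on the window of length `1 / (4 max(√(aε), 1))`. -/
lemma IsAdjSol1D.X1normSq_le_window {δ ε a : ℝ} {φ : ℝ → ℝ → ℝ} (hε : ε ∈ Ioo (0 : ℝ) 1)
    (ha : 0 ≤ a) (hδ : δ = 1 / (4 * max (Real.sqrt (a * ε)) 1)) (h : IsAdjSol1D δ ε a φ) :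
    X1normSq ε (φ 0) ≤ 43200 * Real.exp (1734 * ε⁻¹ * max (Real.sqrt (a * ε)) 1) *
      ∫ t in (0 : ℝ)..δ, φ t 0 ^ 2 := by
  have hε0 := hε.1
  set m := max (Real.sqrt (a * ε)) 1 with hm
  have hm1 : 1 ≤ m := le_max_right _ _
  have hm0 : 0 < m := by linarith
  have hδ0 : 0 < δ := by rw [hδ]; positivity
  have haε : a * ε ≤ m ^ 2 := by
    rw [← Real.sq_sqrt (mul_nonneg ha hε0.le)]
    gcongr
    exact le_max_left _ _
  set y := ε⁻¹ * m with hy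
  have hεy : 1 / ε ≤ y := by
    rw [hy, one_div]; exact le_mul_of_one_le_right (by positivity) hm1
  have hε1 : 1 ≤ 1 / ε := by rw [le_div_iff₀ hε0]; linarith [hε.2]
  have hy1 : 1 ≤ y := hε1.trans hεy
  have hmy : m ≤ y := by
    rw [hy]; rw [one_div] at hε1; exact le_mul_of_one_le_left hm0.le hε1
  have ha' : a ≤ y * m := by
    have : y * m = m ^ 2 / ε := by rw [hy]; field_simp
    rw [this, le_div_iff₀ hε0]; exact haε
  have hquarter : 1 / (4 * ε) = 1 / ε / 4 := by field_simp
  have hexpo : 216 / (ε * δ) + (a + 1 / (4 * ε)) * δ ≤ 865 * y := by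
    have e1 : 216 / (ε * δ) = 864 * y := by rw [hδ, hy]; field_simp; norm_num
    have e2 : (a + 1 / (4 * ε)) * δ ≤ (y * m + y * m) * δ := by
      rw [hquarter]
      gcongr
      nlinarith
    have e3 : (y * m + y * m) * δ = y / 2 := by rw [hδ]; field_simp; norm_num
    linarith
  have hb : 1 + |a - 1 / (4 * ε)| ≤ 5 * Real.exp y := by
    have e1 : |a - 1 / (4 * ε)| ≤ y * y + y * y := by
      rw [hquarter]
      have : y * m ≤ y * y := by gcongr
      rw [abs_le]
      constructor <;> nlinarith
    have e2 := Real.quadratic_le_exp_of_nonneg (by linarith : 0 ≤ y)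
    nlinarith
  have hye : y ≤ Real.exp y := by linarith [Real.add_one_le_exp y]
  set J := ∫ t in (0 : ℝ)..δ, φ t 0 ^ 2 with hJ
  have hJ0 : 0 ≤ J := intervalIntegral.integral_nonneg hδ0.le fun _ _ => sq_nonneg _
  set N := weightedPairing ε (φ 0) (φ 0) with hN
  have hN0 : 0 ≤ N := weightedPairing_self_nonneg hε0 _
  have hwin := h.weightedPairing_le_window hδ0 hε ha
  have h1 : (δ / 3 * Real.exp (-(865 * y))) ^ 2 * N ≤ 48 * (5 * Real.exp y) ^ 2 * (δ * J) := by
    calc _ ≤ (δ / 3 * Real.exp (-(216 / (ε * δ)) - (a + 1 / (4 * ε)) * δ)) ^ 2 * N := by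
          gcongr; linarith
      _ ≤ _ := hwin
      _ ≤ _ := by gcongr
  have hNle : N ≤ 43200 * Real.exp (1733 * y) * J := by
    have e0 : Real.exp (865 * y) * Real.exp (-(865 * y)) = 1 := by rw [← Real.exp_add]; simp
    have e1 : 4 * m * δ = 1 := by rw [hδ]; field_simp
    have e2 : N = (3 * (4 * m) * Real.exp (865 * y)) ^ 2 *
        ((δ / 3 * Real.exp (-(865 * y))) ^ 2 * N) := by
      have : (3 * (4 * m) * Real.exp (865 * y)) ^ 2 * ((δ / 3 * Real.exp (-(865 * y))) ^ 2 * N) =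
        (4 * m * δ) ^ 2 * (Real.exp (865 * y) * Real.exp (-(865 * y))) ^ 2 * N := by ring
      rw [this, e0, e1]; ring
    calc N = _ := e2
      _ ≤ (3 * (4 * m) * Real.exp (865 * y)) ^ 2 * (48 * (5 * Real.exp y) ^ 2 * (δ * J)) := by
          gcongr
      _ = 10800 * (4 * m * δ) * (4 * m) * Real.exp (865 * y) ^ 2 * Real.exp y ^ 2 * J := by ring
      _ ≤ 10800 * 1 * (4 * Real.exp y) * Real.exp (865 * y) ^ 2 * Real.exp y ^ 2 * J := by
          rw [e1]; gcongr; exact hmy.trans hye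
      _ = 43200 * Real.exp (1733 * y) * J := by
          have : Real.exp (1733 * y) = Real.exp y * Real.exp (865 * y) ^ 2 * Real.exp y ^ 2 := by
            rw [← Real.exp_nat_mul, ← Real.exp_nat_mul, ← Real.exp_add, ← Real.exp_add]
            congr 1; push_cast; ring
          rw [this]; ring
  have cφ : Continuous (φ 0) := h.1.continuous.comp (by fun_prop : Continuous fun x : ℝ => ((0 : ℝ), x))
  calc X1normSq ε (φ 0) ≤ Real.exp (1 / ε) * N := X1normSq_le_weightedPairing hε0 cφ
    _ ≤ Real.exp y * (43200 * Real.exp (1733 * y) * J) := by gcongr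
    _ = 43200 * Real.exp (1734 * y) * J := by
        have : Real.exp (1734 * y) = Real.exp y * Real.exp (1733 * y) := by
          rw [← Real.exp_add]; congr 1; ring
        rw [this]; ring
    _ = _ := by rw [hy, ← mul_assoc]

/-- Quantitative observability on the interior time interval `(T/4, 3T/4)`. -/
theorem interior_observability :
    ∃ C > (0:ℝ), ∃ c'' > (0:ℝ), ∀ T ≥ (1:ℝ), ∀ a ≥ (0:ℝ), ∀ ε ∈ Set.Ioo (0:ℝ) 1,
      ∀ φ : ℝ → ℝ → ℝ, IsAdjSol1D T ε a φ →
        (∫ t in (T/4)..(3*T/4), X1normSq ε (φ t)) ≤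
          C * Real.exp (c'' * ε⁻¹ * max (Real.sqrt (a * ε)) 1) *
            ∫ t in (0:ℝ)..T, φ t 0 ^ 2 := by
  refine ⟨43200, by norm_num, 1734, by norm_num, fun T hT a ha ε hε φ h => ?_⟩
  set K := 43200 * Real.exp (1734 * ε⁻¹ * max (Real.sqrt (a * ε)) 1) with hK
  have hK0 : 0 ≤ K := by positivity
  obtain ⟨δ, hδ⟩ : ∃ δ, δ = 1 / (4 * max (Real.sqrt (a * ε)) 1) := ⟨_, rfl⟩
  have hm1 : 1 ≤ max (Real.sqrt (a * ε)) 1 := le_max_right _ _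
  have hδ0 : 0 < δ := by rw [hδ]; positivity
  have hδ1 : δ ≤ 1 / 4 := by
    rw [hδ]
    exact one_div_le_one_div_of_le (by norm_num) (by linarith)
  have cφ := h.1.continuous
  have ch : Continuous fun t => φ t 0 ^ 2 :=
    (cφ.comp (by fun_prop : Continuous fun t : ℝ => (t, (0 : ℝ)))).pow 2
  have csum : Continuous fun p : ℝ × ℝ => φ (p.1 + p.2) 0 ^ 2 := ch.comp (by fun_prop)
  have cX : Continuous fun t => X1normSq ε (φ t) := by
    have cφ2 : Continuous fun p : ℝ × ℝ => φ p.1 p.2 ^ 2 := cφ.pow 2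
    have c1 : Continuous fun t => ∫ x in (-1 : ℝ)..0, φ t x ^ 2 :=
      intervalIntegral.continuous_parametric_intervalIntegral_of_continuous'
        (f := fun t x => φ t x ^ 2) cφ2 (-1) 0
    exact c1.add (continuous_const.mul (ch.add
      ((cφ.comp (by fun_prop : Continuous fun t : ℝ => (t, (-1 : ℝ)))).pow 2)))
  have hJ0 : 0 ≤ ∫ t in (0 : ℝ)..T, φ t 0 ^ 2 :=
    intervalIntegral.integral_nonneg (by linarith) fun _ _ => sq_nonneg _
  calc ∫ t in (T/4)..(3*T/4), X1normSq ε (φ t)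
      ≤ ∫ t in (T/4)..(3*T/4), K * ∫ s in (0 : ℝ)..δ, φ (t + s) 0 ^ 2 := by
        refine intervalIntegral.integral_mono_on (by linarith) (cX.intervalIntegrable _ _)
          (Continuous.intervalIntegrable (continuous_const.mul ?_) _ _) fun t ht => ?_
        · exact intervalIntegral.continuous_parametric_intervalIntegral_of_continuous'
            (f := fun t s => φ (t + s) 0 ^ 2) csum 0 δ
        · have := IsAdjSol1D.X1normSq_le_window hε ha hδ (h.translate (t₀ := t) (δ := δ)
            (by linarith [ht.1]) (by linarith [ht.2]))
          simpa using this
    _ = K * ∫ s in (0 : ℝ)..δ, ∫ t in (T/4)..(3*T/4), φ (t + s) 0 ^ 2 := by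
        rw [intervalIntegral.integral_const_mul,
          integral_integral_swap_of_continuous (F := fun t s => φ (t + s) 0 ^ 2) csum]
    _ ≤ K * ∫ _ in (0 : ℝ)..δ, ∫ t in (0 : ℝ)..T, φ t 0 ^ 2 := by
        gcongr
        refine intervalIntegral.integral_mono_on hδ0.le (Continuous.intervalIntegrable ?_ _ _)
          intervalIntegrable_const fun s hs => ?_
        · exact intervalIntegral.continuous_parametric_intervalIntegral_of_continuous'
            (f := fun s t => φ (t + s) 0 ^ 2) (csum.comp continuous_swap) _ _
        · rw [intervalIntegral.integral_comp_add_right (fun t => φ t 0 ^ 2)]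
          exact intervalIntegral.integral_mono_interval (by linarith [hs.1]) (by linarith)
            (by linarith [hs.2]) (Filter.Eventually.of_forall fun _ => sq_nonneg _)
            (ch.intervalIntegrable _ _)
    _ ≤ K * ∫ t in (0 : ℝ)..T, φ t 0 ^ 2 := by
        gcongr
        rw [intervalIntegral.integral_const, smul_eq_mul]
        exact mul_le_of_le_one_left hJ0 (by linarith)
end
end

section
/- Lower bound on interior energy via dissipation: There exists a constant c0 > 0 such that for every T ≥ 8, every a ≥ 0, every ε ∈ (0,1), and every classical solution φ of (S'^a), one has (T/2) · exp( (c0 T / 16) · ε^{−1/2} max{a^{1/2}, ε^{−1/2}} ) · ‖φ(0,·)‖²_{X¹} ≤ ∫_{T/4}^{3T/4} ‖φ(t,·)‖²_{X¹} dt. -/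
open Real MeasureTheory intervalIntegral Set

noncomputable section

/-- The squared `X¹`-norm with an additional weight `w`. -/
def weightedX1normSq (w : ℝ → ℝ) (ε : ℝ) (ψ : ℝ → ℝ) : ℝ :=
  (∫ x in (-1:ℝ)..0, w x * ψ x ^ 2) + ε * (w 0 * ψ 0 ^ 2 + w (-1) * ψ (-1) ^ 2)

/-- The time derivative of `weightedX1normSq w ε (φ t)` when `ψ = φ t` and `p = ∂_t φ t`. -/
def weightedX1normSqRate (w : ℝ → ℝ) (ε : ℝ) (ψ p : ℝ → ℝ) : ℝ :=
  (∫ x in (-1:ℝ)..0, w x * (2 * ψ x * p x)) +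
    ε * (w 0 * (2 * ψ 0 * p 0) + w (-1) * (2 * ψ (-1) * p (-1)))

lemma mul_weightedX1normSq_le_of_hasDerivAt {w f p B B' : ℝ → ℝ} {r ε : ℝ}
    (hw : Continuous w) (hf : Continuous f) (hp : Continuous p)
    (hB : ∀ x, HasDerivAt B (B' x) x)
    (hle : ∀ x ∈ Ioo (-1:ℝ) 0, B' x ≤ w x * (2 * f x * p x) - r * (w x * f x ^ 2))
    (hbd : r * (ε * (w 0 * f 0 ^ 2 + w (-1) * f (-1) ^ 2)) ≤
      B 0 - B (-1) + ε * (w 0 * (2 * f 0 * p 0) + w (-1) * (2 * f (-1) * p (-1)))) :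
    r * weightedX1normSq w ε f ≤ weightedX1normSqRate w ε f p := by
  have h1 : Continuous fun x => w x * (2 * f x * p x) := by fun_prop
  have h2 : Continuous fun x => r * (w x * f x ^ 2) := by fun_prop
  have key := intervalIntegral.sub_le_integral_of_hasDeriv_right_of_le (a := -1) (b := 0)
    (by norm_num) (fun x _ => (hB x).continuousAt.continuousWithinAt)
    (fun x _ => (hB x).hasDerivWithinAt) ((h1.sub h2).continuousOn.integrableOn_Icc) hle
  simp only [Pi.sub_apply] at key
  rw [intervalIntegral.integral_sub (h1.intervalIntegrable _ _) (h2.intervalIntegrable _ _),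
    intervalIntegral.integral_const_mul] at key
  unfold weightedX1normSq weightedX1normSqRate
  linarith

lemma exp_weight_rate_le {f g h p : ℝ → ℝ} {ε a : ℝ} (hε : 0 < ε) (ha : 0 ≤ a)
    (hf : ∀ x, HasDerivAt f (g x) x) (hg : ∀ x, HasDerivAt g (h x) x) (hp : Continuous p)
    (hpde : ∀ x ∈ Ioo (-1:ℝ) 0, p x + g x + ε * h x - a * f x = 0)
    (h0 : ε * (p 0 - g 0) - f 0 = 0) (h1 : p (-1) + g (-1) = 0) :
    3 / (16 * ε) * weightedX1normSq (fun x => exp (x / (4 * ε))) ε f ≤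
      weightedX1normSqRate (fun x => exp (x / (4 * ε))) ε f p := by
  have hw : ∀ x, HasDerivAt (fun x => exp (x / (4 * ε))) (exp (x / (4 * ε)) * (1 / (4 * ε))) x :=
    fun x => ((hasDerivAt_id x).div_const (4 * ε)).exp
  refine mul_weightedX1normSq_le_of_hasDerivAt
    (B := fun x => exp (x / (4 * ε)) * (-(3 / 4) * f x ^ 2 - 2 * ε * (f x * g x)))
    (by fun_prop)
    (continuous_iff_continuousAt.2 fun x => (hf x).continuousAt) hp
    (fun x => (hw x).mul ((((hf x).pow 2).const_mul (-(3 / 4))).sub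
      (((hf x).mul (hg x)).const_mul (2 * ε)))) ?_ ?_
  · intro x hx
    have hpx : p x = a * f x - g x - ε * h x := by linarith [hpde x hx]
    have hpos : 0 ≤ exp (x / (4 * ε)) * (2 * ε * g x ^ 2 + 2 * a * f x ^ 2) := by positivity
    rw [← sub_nonneg, hpx]
    refine hpos.trans_eq ?_
    simp only [Nat.cast_ofNat, Pi.pow_apply, Pi.mul_apply, Pi.sub_apply]
    field_simp
    ring
  · have e0 : exp ((0:ℝ) / (4 * ε)) = 1 := by simp
    have hp0 : ε * p 0 = ε * g 0 + f 0 := by linarith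
    have hp1 : p (-1) = - g (-1) := by linarith
    simp only [e0]
    have hE : 0 ≤ exp (-1 / (4 * ε)) * f (-1) ^ 2 := by positivity
    have hl : 3 / (16 * ε) * (ε * (1 * f 0 ^ 2 + exp (-1 / (4 * ε)) * f (-1) ^ 2)) =
        3 / 16 * (f 0 ^ 2 + exp (-1 / (4 * ε)) * f (-1) ^ 2) := by
      field_simp
    rw [hl, hp1]
    have hx : f 0 * (ε * p 0) = f 0 * (ε * g 0 + f 0) := by rw [hp0]
    nlinarith [sq_nonneg (f 0)]

lemma unit_weight_rate_le {f g h p : ℝ → ℝ} {ε a s : ℝ} (hε : 0 < ε) (hε1 : ε ≤ 1)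
    (hs : 0 ≤ s) (hsa : s ≤ a) (hsε : ε * s ^ 2 ≤ a)
    (hf : ∀ x, HasDerivAt f (g x) x) (hg : ∀ x, HasDerivAt g (h x) x) (hp : Continuous p)
    (hpde : ∀ x ∈ Ioo (-1:ℝ) 0, p x + g x + ε * h x - a * f x = 0)
    (h0 : ε * (p 0 - g 0) - f 0 = 0) (h1 : p (-1) + g (-1) = 0) :
    s / 2 * weightedX1normSq (fun _ => 1) ε f ≤ weightedX1normSqRate (fun _ => 1) ε f p := by
  have hl : ∀ x : ℝ, HasDerivAt (fun x : ℝ => 1 + 2 * x) (2 * 1) x :=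
    fun x => ((hasDerivAt_id x).const_mul 2).const_add 1
  refine mul_weightedX1normSq_le_of_hasDerivAt
    (B := fun x => -1 * f x ^ 2 - 2 * ε * (f x * g x) + s * ε / 2 * ((1 + 2 * x) * f x ^ 2))
    (by fun_prop)
    (continuous_iff_continuousAt.2 fun x => (hf x).continuousAt) hp
    (fun x => ((((hf x).pow 2).const_mul (-1)).sub
      (((hf x).mul (hg x)).const_mul (2 * ε))).add
        (((hl x).mul ((hf x).pow 2)).const_mul (s * ε / 2))) ?_ ?_
  · intro x hx
    have hpx : p x = a * f x - g x - ε * h x := by linarith [hpde x hx]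
    rw [hpx]
    simp only [Nat.cast_ofNat, Pi.pow_apply]
    have hF := sq_nonneg (f x)
    have i1 : s * f x ^ 2 ≤ a * f x ^ 2 := by gcongr
    have i2 : s * ε * f x ^ 2 ≤ a * f x ^ 2 := by
      gcongr
      nlinarith
    have i3 : ε * s ^ 2 * f x ^ 2 ≤ a * f x ^ 2 := by gcongr
    have hy : (1 + 2 * x) ^ 2 ≤ 1 := by nlinarith [hx.1, hx.2]
    have i4 : (1 + 2 * x) ^ 2 * (ε * g x ^ 2) ≤ 1 * (ε * g x ^ 2) := by gcongr
    have i5 : 0 ≤ ε * (s * f x - (1 + 2 * x) * g x) ^ 2 := by positivity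
    have i6 : 0 ≤ ε * g x ^ 2 := by positivity
    linear_combination i1 / 2 + i2 + i3 / 2 + i4 / 2 + i5 / 2 + 3 / 2 * i6
  · have hp0 : ε * p 0 = ε * g 0 + f 0 := by linarith
    have hp1 : p (-1) = - g (-1) := by linarith
    rw [hp1]
    have hx : f 0 * (ε * p 0) = f 0 * (ε * g 0 + f 0) := by rw [hp0]
    nlinarith [sq_nonneg (f 0), sq_nonneg (f (-1))]

lemma hasDerivAt_weightedX1normSq {φ φt : ℝ → ℝ → ℝ} {w : ℝ → ℝ} (ε : ℝ) (hw : Continuous w)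
    (hφ : Continuous fun q : ℝ × ℝ => φ q.1 q.2) (hφt : Continuous fun q : ℝ × ℝ => φt q.1 q.2)
    (hd : ∀ t x, HasDerivAt (fun s => φ s x) (φt t x) t) (t : ℝ) :
    HasDerivAt (fun t => weightedX1normSq w ε (φ t)) (weightedX1normSqRate w ε (φ t) (φt t)) t := by
  have hsq : ∀ t x, HasDerivAt (fun s => w x * φ s x ^ 2) (w x * (2 * φ t x * φt t x)) t := by
    intro t x
    simpa using ((hd t x).pow 2).const_mul (w x)
  have hc : Continuous fun q : ℝ × ℝ => w q.2 * (2 * φ q.1 q.2 * φt q.1 q.2) := by fun_prop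
  have hslice : ∀ s, Continuous fun x => w x * φ s x ^ 2 := fun s =>
    hw.mul ((hφ.comp (Continuous.prodMk_right s)).pow 2)
  have hslice' : ∀ s, Continuous fun x => w x * (2 * φ s x * φt s x) := fun s =>
    hc.comp (Continuous.prodMk_right s)
  obtain ⟨C, hC⟩ := ((isCompact_Icc (a := t - 1) (b := t + 1)).prod
    (isCompact_Icc (a := (-1:ℝ)) (b := 0))).exists_bound_of_continuousOn hc.continuousOn
  have hint := intervalIntegral.hasDerivAt_integral_of_dominated_loc_of_deriv_le
    (μ := volume) (a := -1) (b := 0) (x₀ := t) (s := Icc (t - 1) (t + 1)) (bound := fun _ => C)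
    (F := fun s x => w x * φ s x ^ 2) (F' := fun s x => w x * (2 * φ s x * φt s x))
    (Icc_mem_nhds (by linarith) (by linarith))
    (Filter.Eventually.of_forall fun s => (hslice s).aestronglyMeasurable)
    ((hslice t).intervalIntegrable _ _)
    (hslice' t).aestronglyMeasurable
    (Filter.Eventually.of_forall fun x hx s hs => hC (s, x) ⟨hs, by
      rw [uIoc_of_le (by norm_num)] at hx
      exact Ioc_subset_Icc_self hx⟩)
    (by simp) (Filter.Eventually.of_forall fun x _ s _ => hsq s x)
  exact hint.2.add (((hsq t 0).add (hsq t (-1))).const_mul ε)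

lemma exp_mul_le_of_mul_le_deriv {E E' : ℝ → ℝ} {r T : ℝ} (hE : ∀ t, HasDerivAt E (E' t) t)
    (hle : ∀ t ∈ Ioo 0 T, r * E t ≤ E' t) {t : ℝ} (ht : t ∈ Icc 0 T) :
    exp (r * t) * E 0 ≤ E t := by
  have hG : ∀ t, HasDerivAt (fun t => exp (-(r * t)) * E t)
      (exp (-(r * t)) * (E' t - r * E t)) t := by
    intro t
    have := ((((hasDerivAt_id t).const_mul r).neg).exp).mul (hE t)
    refine this.congr_deriv ?_
    simp only [id, Pi.neg_apply]
    ring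
  have hmono : MonotoneOn (fun t => exp (-(r * t)) * E t) (Icc 0 T) := by
    refine monotoneOn_of_deriv_nonneg (convex_Icc 0 T)
      (fun x _ => (hG x).continuousAt.continuousWithinAt)
      (fun x _ => (hG x).differentiableAt.differentiableWithinAt) fun x hx => ?_
    rw [interior_Icc] at hx
    rw [(hG x).deriv]
    exact mul_nonneg (exp_pos _).le (sub_nonneg.2 (hle x hx))
  have h := hmono (left_mem_Icc.2 (ht.1.trans ht.2)) ht ht.1
  simp only [mul_zero, neg_zero, exp_zero, one_mul] at h
  calc exp (r * t) * E 0 ≤ exp (r * t) * (exp (-(r * t)) * E t) := by gcongr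
    _ = E t := by rw [← mul_assoc, ← exp_add]; simp

lemma weightedX1normSq_mono {w v : ℝ → ℝ} {ε : ℝ} {ψ : ℝ → ℝ} (hε : 0 ≤ ε) (hw : Continuous w)
    (hv : Continuous v) (hψ : Continuous ψ) (hle : ∀ x ∈ Icc (-1:ℝ) 0, w x ≤ v x) :
    weightedX1normSq w ε ψ ≤ weightedX1normSq v ε ψ := by
  have h0 := hle 0 (by norm_num)
  have h1 := hle (-1) (by norm_num)
  unfold weightedX1normSq
  gcongr
  refine intervalIntegral.integral_mono_on (by norm_num)
    (Continuous.intervalIntegrable (by fun_prop) _ _)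
    (Continuous.intervalIntegrable (by fun_prop) _ _) fun x hx => ?_
  have := hle x hx
  gcongr

lemma weightedX1normSq_const (c ε : ℝ) (ψ : ℝ → ℝ) :
    weightedX1normSq (fun _ => c) ε ψ = c * X1normSq ε ψ := by
  simp only [weightedX1normSq, X1normSq, intervalIntegral.integral_const_mul]
  ring

lemma X1normSq_nonneg {ε : ℝ} (hε : 0 ≤ ε) (ψ : ℝ → ℝ) : 0 ≤ X1normSq ε ψ := by
  have : 0 ≤ ∫ x in (-1:ℝ)..0, ψ x ^ 2 :=
    intervalIntegral.integral_nonneg (by norm_num) fun x _ => sq_nonneg _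
  unfold X1normSq
  positivity

/-- Partial derivatives of a smooth function of two variables. -/
lemma hasDerivAt_slices {φ : ℝ → ℝ → ℝ}
    (hφ : ContDiff ℝ (⊤ : ℕ∞) (fun p : ℝ × ℝ => φ p.1 p.2)) :
    (∀ t x, HasDerivAt (fun s => φ s x) (deriv (fun s => φ s x) t) t) ∧
    (Continuous fun q : ℝ × ℝ => deriv (fun s => φ s q.2) q.1) ∧
    (∀ t x, HasDerivAt (φ t) (deriv (φ t) x) x) ∧
    ∀ t x, HasDerivAt (deriv (φ t)) (deriv (deriv (φ t)) x) x := by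
  have h1 : ∀ x, ContDiff ℝ (⊤ : ℕ∞) fun s => φ s x := fun x =>
    hφ.comp (contDiff_id.prodMk contDiff_const)
  have h2 : ∀ t, ContDiff ℝ (⊤ : ℕ∞) (φ t) := fun t =>
    hφ.comp (contDiff_const.prodMk contDiff_id)
  have hne : ((⊤ : ℕ∞) : WithTop ℕ∞) ≠ 0 := by simp
  refine ⟨fun t x => ((h1 x).differentiable hne t).hasDerivAt, ?_,
    fun t x => ((h2 t).differentiable hne x).hasDerivAt, fun t x => ?_⟩
  · have heq : (fun q : ℝ × ℝ => deriv (fun s => φ s q.2) q.1) =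
        fun q => fderiv ℝ (fun p : ℝ × ℝ => φ p.1 p.2) q (1, 0) := by
      funext q
      have hd := (hφ.differentiable hne q).hasFDerivAt
      have hc : HasDerivAt (fun s : ℝ => (s, q.2)) ((1:ℝ), (0:ℝ)) q.1 :=
        (hasDerivAt_id _).prodMk (hasDerivAt_const _ _)
      exact (hd.comp_hasDerivAt q.1 hc).deriv
    rw [heq]
    exact (hφ.continuous_fderiv hne).clm_apply continuous_const
  · have h3 : ContDiff ℝ 1 (deriv (φ t)) :=
      ((contDiff_succ_iff_deriv (n := 1)).1 (contDiff_infty.1 (h2 t) 2)).2.2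
    exact (h3.differentiable (by simp) x).hasDerivAt

/-- Exponential growth of the energy from time `0` to any time `t ∈ [T/4, T]`. -/
lemma IsAdjSol1D.exp_mul_X1normSq_le {T ε a : ℝ} {φ : ℝ → ℝ → ℝ} (hφ : IsAdjSol1D T ε a φ)
    (hT : 8 ≤ T) (ha : 0 ≤ a) (hε : ε ∈ Ioo (0:ℝ) 1) {t : ℝ} (ht : t ∈ Icc (T / 4) T) :
    exp ((1 / 4 * T / 16) * (√ε)⁻¹ * max (√a) (√ε)⁻¹) * X1normSq ε (φ 0) ≤
      X1normSq ε (φ t) := by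
  obtain ⟨hsm, hpde, hbc0, hbc1⟩ := hφ
  obtain ⟨hdt, hct, hdx, hdxx⟩ := hasDerivAt_slices hsm
  obtain ⟨hε0, hε1⟩ := hε
  have hsε : 0 < √ε := Real.sqrt_pos.2 hε0
  have hsqε : √ε ^ 2 = ε := Real.sq_sqrt hε0.le
  have hsqa : √a ^ 2 = a := Real.sq_sqrt ha
  have hcont : ∀ t, Continuous (φ t) := fun t => hsm.continuous.comp (Continuous.prodMk_right t)
  have hpt : ∀ t, Continuous fun x => deriv (fun s => φ s x) t := fun t =>
    hct.comp (Continuous.prodMk_right t)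
  have hder : ∀ (w : ℝ → ℝ), Continuous w → ∀ t, HasDerivAt (fun t => weightedX1normSq w ε (φ t))
      (weightedX1normSqRate w ε (φ t) fun x => deriv (fun s => φ s x) t) t := fun w hw =>
    hasDerivAt_weightedX1normSq (φt := fun t x => deriv (fun s => φ s x) t) ε hw
      hsm.continuous hct hdt
  have htT : t ∈ Icc 0 T := ⟨by linarith [ht.1], ht.2⟩
  have hN := X1normSq_nonneg hε0.le (φ 0)
  rcases le_total (√a) (√ε)⁻¹ with hcase | hcase
  · rw [max_eq_right hcase]
    have hw : Continuous fun x => exp (x / (4 * ε)) := by fun_prop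
    have hgrow := exp_mul_le_of_mul_le_deriv (hder _ hw) (r := 3 / (16 * ε)) (T := T)
      (fun t ht => exp_weight_rate_le hε0 ha (hdx t) (hdxx t) (hpt t) (hpde t ht) (hbc0 t ht)
        (hbc1 t ht)) htT
    have hup : weightedX1normSq (fun x => exp (x / (4 * ε))) ε (φ t) ≤ 1 * X1normSq ε (φ t) := by
      rw [← weightedX1normSq_const]
      refine weightedX1normSq_mono hε0.le hw continuous_const (hcont t) fun x hx => ?_
      exact exp_le_one_iff.2 (div_nonpos_of_nonpos_of_nonneg hx.2 (by positivity))
    have hlow : exp (-1 / (4 * ε)) * X1normSq ε (φ 0) ≤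
        weightedX1normSq (fun x => exp (x / (4 * ε))) ε (φ 0) := by
      rw [← weightedX1normSq_const]
      refine weightedX1normSq_mono hε0.le continuous_const hw (hcont 0) fun x hx => ?_
      have := hx.1
      gcongr
    have hexp : 1 / 4 * T / 16 * (√ε)⁻¹ * (√ε)⁻¹ ≤ 3 / (16 * ε) * t + -1 / (4 * ε) := by
      have e1 : 1 / 4 * T / 16 * (√ε)⁻¹ * (√ε)⁻¹ = (T / 64) / ε := by
        rw [mul_assoc, ← mul_inv, ← sq, hsqε]
        ring
      have e2 : 3 / (16 * ε) * t + -1 / (4 * ε) = (3 * t / 16 - 1 / 4) / ε := by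
        field_simp
        ring
      rw [e1, e2]
      gcongr
      linarith [ht.1]
    calc _ ≤ exp (3 / (16 * ε) * t + -1 / (4 * ε)) * X1normSq ε (φ 0) := by gcongr
      _ = exp (3 / (16 * ε) * t) * (exp (-1 / (4 * ε)) * X1normSq ε (φ 0)) := by
        rw [exp_add, mul_assoc]
      _ ≤ exp (3 / (16 * ε) * t) * weightedX1normSq (fun x => exp (x / (4 * ε))) ε (φ 0) := by
        gcongr
      _ ≤ _ := hgrow
      _ ≤ _ := hup
      _ = _ := one_mul _
  · rw [max_eq_left hcase]
    have hs0 : 0 ≤ (√ε)⁻¹ * √a := by positivity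
    have hgrow := exp_mul_le_of_mul_le_deriv (hder _ (continuous_const (y := (1:ℝ))))
      (r := (√ε)⁻¹ * √a / 2) (T := T)
      (fun t ht => unit_weight_rate_le (a := a) hε0 hε1.le hs0
        (by nlinarith [mul_le_mul_of_nonneg_right hcase (Real.sqrt_nonneg a)])
        (by
          rw [mul_pow, inv_pow, hsqε, hsqa]
          exact (mul_inv_cancel_left₀ hε0.ne' a).le)
        (hdx t) (hdxx t) (hpt t) (hpde t ht) (hbc0 t ht) (hbc1 t ht)) htT
    simp only [weightedX1normSq_const, one_mul] at hgrow
    refine le_trans ?_ hgrow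
    refine mul_le_mul_of_nonneg_right (exp_le_exp.2 ?_) hN
    nlinarith [ht.1, mul_le_mul_of_nonneg_left ht.1 hs0, mul_nonneg hs0 (by linarith : 0 ≤ T)]

/-- Lower bound on the interior energy via dissipation. -/
theorem interior_energy_lower_bound :
    ∃ c0 > (0:ℝ), ∀ T ≥ (8:ℝ), ∀ a ≥ (0:ℝ), ∀ ε ∈ Set.Ioo (0:ℝ) 1,
      ∀ φ : ℝ → ℝ → ℝ, IsAdjSol1D T ε a φ →
        T / 2 * Real.exp ((c0 * T / 16) * (Real.sqrt ε)⁻¹ *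
              max (Real.sqrt a) (Real.sqrt ε)⁻¹) * X1normSq ε (φ 0) ≤
          ∫ t in (T/4)..(3*T/4), X1normSq ε (φ t) := by
  refine ⟨1 / 4, by norm_num, fun T hT a ha ε hε φ hφ => ?_⟩
  have hT' : (8:ℝ) ≤ T := hT
  obtain ⟨hdt, hct, -, -⟩ := hasDerivAt_slices hφ.1
  have hcont : Continuous fun t => X1normSq ε (φ t) := by
    refine continuous_iff_continuousAt.2 fun t => ?_
    have := (hasDerivAt_weightedX1normSq (φt := fun t x => deriv (fun s => φ s x) t) ε
      (continuous_const (y := (1:ℝ))) hφ.1.continuous hct hdt t).continuousAt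
    simpa only [weightedX1normSq_const, one_mul] using this
  calc _ = ∫ _ in (T / 4)..(3 * T / 4), exp ((1 / 4 * T / 16) * (√ε)⁻¹ * max (√a) (√ε)⁻¹) *
        X1normSq ε (φ 0) := by
        rw [intervalIntegral.integral_const, smul_eq_mul]
        ring
    _ ≤ _ := intervalIntegral.integral_mono_on (by linarith) (by simp)
        (hcont.intervalIntegrable _ _) fun t ht =>
          hφ.exp_mul_X1normSq_le hT' ha hε ⟨ht.1, by linarith [ht.2]⟩
end
end
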